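/- Let J be a closed ideal of the Banach algebra D(μ) ∩ H^∞, let π : D(μ) ∩ H^∞ → (D(μ) ∩ H^∞)/J be the canonical quotient map, and let u denote the identity function u(z) = z. Then the spectrum of π(u) in the quotient Banach algebra equals Z̲(J) := ⋂_{f ∈ J} Z̲(f). -/

import Mathlib

open MeasureTheory Metric Filter Complex Set
open scoped ENNReal Topology

noncomputable section

namespace DirichletMu

/-- The open unit disc in `ℂ`. -/
def disc : Set ℂ := Metric.ball 0 1

/-- The unit circle `𝕋`. -/
def circleT : Set ℂ := Metric.sphere 0 1

/-- The boundary point `e^{it}`. -/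
def bpt (t : ℝ) : ℂ := Complex.exp (Complex.I * (t : ℂ))

/-- Arc-length parametrizing measure on `(0, 2π]`. -/
def θm : Measure ℝ := volume.restrict (Set.Ioc 0 (2 * Real.pi))

/-- A measure is carried by the unit circle. -/
def OnCircle (μ : Measure ℂ) : Prop := μ circleTᶜ = 0

/-- The mean-square integrals of `f` over circles of radius `r < 1`. -/
def hardySet (f : ℂ → ℂ) : Set ℝ :=
  {x | ∃ r : ℝ, 0 < r ∧ r < 1 ∧
    x = (1 / (2 * Real.pi)) * ∫ t in (0:ℝ)..(2 * Real.pi), ‖f ((r : ℂ) * bpt t)‖ ^ 2}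

/-- Membership in the Hardy space `H²`. -/
def MemHardy2 (f : ℂ → ℂ) : Prop :=
  DifferentiableOn ℂ f disc ∧ BddAbove (hardySet f)

/-- The squared Hardy norm. -/
def hardyNormSq (f : ℂ → ℂ) : ℝ := sSup (hardySet f)

/-- Membership in `H^∞`. -/
def MemHinf (f : ℂ → ℂ) : Prop :=
  DifferentiableOn ℂ f disc ∧ ∃ C : ℝ, ∀ z ∈ disc, ‖f z‖ ≤ C

/-- The sup norm over the disc. -/
def supNorm (f : ℂ → ℂ) : ℝ := sSup ((fun z => ‖f z‖) '' disc)

/-- The Poisson integral of the measure `μ`. -/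
def poissonMu (μ : Measure ℂ) (z : ℂ) : ℝ :=
  ∫ ζ, (1 - ‖z‖ ^ 2) / ‖1 - (starRingEnd ℂ) ζ * z‖ ^ 2 ∂μ

/-- The integrand of the Dirichlet integral. -/
def dirichletDensity (μ : Measure ℂ) (f : ℂ → ℂ) (z : ℂ) : ℝ :=
  ‖deriv f z‖ ^ 2 * poissonMu μ z

/-- The Dirichlet integral `D_μ(f)`. -/
def dirichletIntegral (μ : Measure ℂ) (f : ℂ → ℂ) : ℝ :=
  (1 / Real.pi) * ∫ z in disc, dirichletDensity μ f z

/-- Membership in the Dirichlet-type space `D(μ)`. -/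
def MemD (μ : Measure ℂ) (f : ℂ → ℂ) : Prop :=
  MemHardy2 f ∧ IntegrableOn (dirichletDensity μ f) disc

/-- The squared norm `‖f‖_μ²` of `D(μ)`. -/
def dNormSq (μ : Measure ℂ) (f : ℂ → ℂ) : ℝ :=
  hardyNormSq f + dirichletIntegral μ f

/-- `f` has radial limit `L` at `ζ`. -/
def HasRadialLimitAt (f : ℂ → ℂ) (ζ L : ℂ) : Prop :=
  Tendsto (fun r : ℝ => f ((r : ℂ) * ζ)) (nhdsWithin 1 (Set.Iio 1)) (nhds L)

/-- The modulus of `f` has radial limit `m` at `e^{it}`. -/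
def BoundaryAbs (f : ℂ → ℂ) (t : ℝ) (m : ℝ) : Prop :=
  Tendsto (fun r : ℝ => ‖f ((r : ℂ) * bpt t)‖) (nhdsWithin 1 (Set.Iio 1)) (nhds m)

/-- The boundary zero set `Z_𝕋(f)`. -/
def ZT (f : ℂ → ℂ) : Set ℂ :=
  {ζ | ζ ∈ circleT ∧ HasRadialLimitAt f ζ 0}

/-- The set `Z̲(f)`. -/
def Zlow (f : ℂ → ℂ) : Set ℂ :=
  {ζ | ζ ∈ Metric.closedBall (0 : ℂ) 1 ∧
    Filter.liminf (fun z => ‖f z‖) (nhdsWithin ζ disc) = 0}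

def ZlowSet (S : Set (ℂ → ℂ)) : Set ℂ := ⋂ f ∈ S, Zlow f

def ZTSet (S : Set (ℂ → ℂ)) : Set ℂ := ⋂ f ∈ S, ZT f

/-- `[f]_{D(μ)}`: the closure in `D(μ)` of the polynomial multiples of `f`. -/
def closedSpan (μ : Measure ℂ) (f : ℂ → ℂ) : Set (ℂ → ℂ) :=
  {g | MemD μ g ∧ ∀ ε > 0, ∃ q : Polynomial ℂ,
    dNormSq μ (fun z => g z - q.eval z * f z) < ε}

/-- `f` is cyclic for `D(μ)`. -/
def IsCyclic (μ : Measure ℂ) (f : ℂ → ℂ) : Prop :=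
  closedSpan μ f = {g | MemD μ g}

/-- `f` is the outer function with boundary modulus `φ` (parametrized by `e^{it}`). -/
def OuterWith (f : ℂ → ℂ) (φ : ℝ → ℝ) : Prop :=
  (∀ t, 0 ≤ φ t) ∧
  IntervalIntegrable (fun t => Real.log (φ t)) volume 0 (2 * Real.pi) ∧
  ∀ z ∈ disc, f z = Complex.exp (((2 * Real.pi : ℝ) : ℂ)⁻¹ *
    ∫ t in (0:ℝ)..(2 * Real.pi), ((bpt t + z) / (bpt t - z)) * (Real.log (φ t) : ℂ))

/-- `f` is an outer function. -/
def IsOuter (f : ℂ → ℂ) : Prop := ∃ φ, OuterWith f φ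

/-- Inner functions. -/
def IsInner (f : ℂ → ℂ) : Prop :=
  DifferentiableOn ℂ f disc ∧ (∀ z ∈ disc, ‖f z‖ ≤ 1) ∧
  ∀ᵐ t ∂θm, BoundaryAbs f t 1

/-- `f / Θ ∈ H²`. -/
def InnerDivides (Θ f : ℂ → ℂ) : Prop :=
  ∃ g, MemHardy2 g ∧ ∀ z ∈ disc, f z = Θ z * g z

/-- `Θ / Θ'` is bounded on the disc. -/
def DividesBdd (Θ' Θ : ℂ → ℂ) : Prop :=
  ∃ g, MemHinf g ∧ ∀ z ∈ disc, Θ z = Θ' z * g z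

/-- `Θ` is the greatest common inner divisor of the family `M`. -/
def IsGCDInner (M : Set (ℂ → ℂ)) (Θ : ℂ → ℂ) : Prop :=
  IsInner Θ ∧ (∀ f ∈ M, InnerDivides Θ f) ∧
  ∀ Θ', IsInner Θ' → (∀ f ∈ M, InnerDivides Θ' f) → DividesBdd Θ' Θ

/-- The set `Θ H²`. -/
def innerMulH2 (Θ : ℂ → ℂ) : Set (ℂ → ℂ) :=
  {h | ∃ g, MemHardy2 g ∧ ∀ z ∈ disc, h z = Θ z * g z}

/-- Poisson extension of a boundary function (parametrized by `e^{it}`). -/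
def poissonExt (u : ℝ → ℝ) (z : ℂ) : ℝ :=
  (1 / (2 * Real.pi)) * ∫ t in (0:ℝ)..(2 * Real.pi),
    ((1 - ‖z‖ ^ 2) / ‖bpt t - z‖ ^ 2) * u t

/-- `|∇ P[u]|² P_μ`. -/
def gradDensity (μ : Measure ℂ) (u : ℝ → ℝ) (z : ℂ) : ℝ :=
  ‖fderiv ℝ (poissonExt u) z‖ ^ 2 * poissonMu μ z

/-- Membership in the harmonic Dirichlet space `D^h(μ)`. -/
def MemDh (μ : Measure ℂ) (u : ℝ → ℝ) : Prop :=
  IntegrableOn (fun t => (u t) ^ 2) (Set.Ioc 0 (2 * Real.pi)) volume ∧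
  IntegrableOn (gradDensity μ u) disc

/-- The squared norm of `D^h(μ)`. -/
def dhNormSq (μ : Measure ℂ) (u : ℝ → ℝ) : ℝ :=
  (1 / (2 * Real.pi)) * (∫ t in Set.Ioc 0 (2 * Real.pi), (u t) ^ 2) +
  (1 / Real.pi) * ∫ z in disc, gradDensity μ u z

/-- Relatively open subsets of the circle. -/
def RelOpen (U : Set ℂ) : Prop := ∃ V : Set ℂ, IsOpen V ∧ U = V ∩ circleT

/-- Capacity of a relatively open subset of the circle. -/
def capOpen (μ : Measure ℂ) (U : Set ℂ) : ℝ≥0∞ :=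
  ⨅ (u : ℝ → ℝ) (_ : MemDh μ u ∧ (∀ t, 0 ≤ u t) ∧
      ∀ᵐ t ∂θm, bpt t ∈ U → 1 ≤ u t),
    ENNReal.ofReal (dhNormSq μ u)

/-- The capacity `c_μ` of an arbitrary subset of the circle. -/
def cap (μ : Measure ℂ) (F : Set ℂ) : ℝ≥0∞ :=
  ⨅ (U : Set ℂ) (_ : RelOpen U ∧ F ⊆ U), capOpen μ U

/-- The (closed) support of a measure on `ℂ`. -/
def msupport (μ : Measure ℂ) : Set ℂ :=
  {x | ∀ r > 0, 0 < μ (Metric.ball x r)}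

/-- `M_μ(E)`: functions of `D(μ)` whose radial limits vanish `c_μ`-q.e. on `E`. -/
def Mspace (μ : Measure ℂ) (E : Set ℂ) : Set (ℂ → ℂ) :=
  {g | MemD μ g ∧ ∃ N : Set ℂ, cap μ N = 0 ∧ ∀ ζ ∈ E \ N, HasRadialLimitAt g ζ 0}

/-- Closed shift-invariant subspaces of `D(μ)` (closedness for the `D(μ)` norm). -/
structure ClosedInvSubspace (μ : Measure ℂ) (M : Set (ℂ → ℂ)) : Prop where
  subset : M ⊆ {f | MemD μ f}
  zero_mem : (fun _ => (0 : ℂ)) ∈ M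
  add_mem : ∀ f ∈ M, ∀ g ∈ M, (fun z => f z + g z) ∈ M
  smul_mem : ∀ (c : ℂ), ∀ f ∈ M, (fun z => c * f z) ∈ M
  shift_mem : ∀ f ∈ M, (fun z => z * f z) ∈ M
  closed : ∀ g, MemD μ g →
    (∀ ε > 0, ∃ h ∈ M, dNormSq μ (fun z => g z - h z) < ε) → g ∈ M

/-- The norm `‖f‖_{∞,μ}` of the Banach algebra `D(μ) ∩ H^∞`. -/
def algNorm (μ : Measure ℂ) (f : ℂ → ℂ) : ℝ :=
  supNorm f + Real.sqrt (dirichletIntegral μ f)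

/-- Membership in the Banach algebra `D(μ) ∩ H^∞`. -/
def MemA (μ : Measure ℂ) (f : ℂ → ℂ) : Prop := MemD μ f ∧ MemHinf f

/-- Closed ideals of `D(μ) ∩ H^∞`. -/
structure ClosedIdeal (μ : Measure ℂ) (J : Set (ℂ → ℂ)) : Prop where
  subset : J ⊆ {f | MemA μ f}
  zero_mem : (fun _ => (0 : ℂ)) ∈ J
  add_mem : ∀ f ∈ J, ∀ g ∈ J, (fun z => f z + g z) ∈ J
  mul_mem : ∀ f, MemA μ f → ∀ g ∈ J, (fun z => f z * g z) ∈ J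
  closed : ∀ g, MemA μ g →
    (∀ ε > 0, ∃ h ∈ J, algNorm μ (fun z => g z - h z) < ε) → g ∈ J

/-- A multiplier of `D(μ)`. -/
def IsMultiplier (μ : Measure ℂ) (φ : ℂ → ℂ) : Prop :=
  DifferentiableOn ℂ φ disc ∧ ∀ g, MemD μ g → MemD μ (fun z => φ z * g z)

/-- Distance between two subsets of `ℂ`. -/
def setDist (A B : Set ℂ) : ℝ :=
  sInf ((fun p : ℂ × ℂ => dist p.1 p.2) '' (A ×ˢ B))

/-- A Cauchy-type kernel with quadratic decay along horizontal lines. -/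
def cauchyKernel (u : ℂ) : ℂ := 1 / u - 1 / (u + 10 * I)

lemma norm_sq_ofReal_add (a : ℂ) (t : ℝ) : ‖(t : ℂ) + a‖ ^ 2 = (t + a.re) ^ 2 + a.im ^ 2 := by
  rw [← Complex.normSq_eq_norm_sq, Complex.normSq_apply]
  simp; ring

lemma inv_norm_sq_le {a : ℂ} {c : ℝ} (hc : 0 < c) (hc1 : c ≤ 1) (ha : c ≤ |a.im|) (t : ℝ) :
    (‖(t : ℂ) + a‖ ^ 2)⁻¹ ≤ (c ^ 2)⁻¹ * (1 + (t + a.re) ^ 2)⁻¹ := by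
  rw [← mul_inv, norm_sq_ofReal_add]
  have h2 : c ^ 2 ≤ a.im ^ 2 := by
    rw [← sq_abs a.im]; gcongr
  have h3 : c ^ 2 ≤ 1 := pow_le_one₀ hc.le hc1
  apply inv_anti₀ (by positivity)
  nlinarith [sq_nonneg (t + a.re)]

lemma ofReal_add_ne_zero {a : ℂ} (ha : a.im ≠ 0) (t : ℝ) : (t : ℂ) + a ≠ 0 := by
  intro h
  apply ha
  simpa using congrArg Complex.im h

lemma integrable_inv_one_add_shift (x : ℝ) :
    Integrable (fun t : ℝ => (1 + (t + x) ^ 2)⁻¹) :=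
  integrable_inv_one_add_sq.comp_add_right x

lemma integral_inv_one_add_shift (x : ℝ) :
    ∫ t : ℝ, (1 + (t + x) ^ 2)⁻¹ = Real.pi := by
  rw [← integral_univ_inv_one_add_sq]
  exact integral_add_right_eq_self (fun t : ℝ => (1 + t ^ 2)⁻¹) x

lemma continuous_inv_norm_sq {a : ℂ} (ha : a.im ≠ 0) :
    Continuous (fun t : ℝ => (‖(t : ℂ) + a‖ ^ 2)⁻¹) := by
  apply Continuous.inv₀ (by fun_prop)
  intro t
  have := ofReal_add_ne_zero ha t
  positivity

lemma integrable_inv_norm_sq {a : ℂ} (ha : a.im ≠ 0) :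
    Integrable (fun t : ℝ => (‖(t : ℂ) + a‖ ^ 2)⁻¹) := by
  have hc : 0 < min 1 |a.im| := by positivity
  refine ((integrable_inv_one_add_shift a.re).const_mul ((min 1 |a.im| ^ 2)⁻¹)).mono'
    (continuous_inv_norm_sq ha).aestronglyMeasurable (Eventually.of_forall fun t => ?_)
  rw [Real.norm_of_nonneg (by positivity)]
  exact inv_norm_sq_le hc (min_le_left _ _) (min_le_right _ _) t

lemma integral_inv_norm_sq_le {a : ℂ} {c : ℝ} (hc : 0 < c) (hc1 : c ≤ 1) (ha : c ≤ |a.im|) :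
    ∫ t : ℝ, (‖(t : ℂ) + a‖ ^ 2)⁻¹ ≤ (c ^ 2)⁻¹ * Real.pi := by
  have ha' : a.im ≠ 0 := abs_pos.1 (hc.trans_le ha)
  rw [← integral_inv_one_add_shift a.re, ← integral_const_mul]
  exact integral_mono (integrable_inv_norm_sq ha')
    ((integrable_inv_one_add_shift a.re).const_mul _) (inv_norm_sq_le hc hc1 ha)

/-- The sum of inverse squares controlling `cauchyKernel` and its derivative. -/
def kernelMajorant (u : ℂ) : ℝ := (‖u‖ ^ 2)⁻¹ + (‖u + 10 * I‖ ^ 2)⁻¹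

lemma norm_cauchyKernel_le {u : ℂ} (h0 : u ≠ 0) (h1 : u + 10 * I ≠ 0) :
    ‖cauchyKernel u‖ ≤ 5 * kernelMajorant u := by
  have : cauchyKernel u = 10 * I / (u * (u + 10 * I)) := by
    unfold cauchyKernel; field_simp; ring
  rw [this, kernelMajorant]
  simp only [norm_div, norm_mul, Complex.norm_I, mul_one, Complex.norm_ofNat]
  have a0 : 0 < ‖u‖ := norm_pos_iff.2 h0
  have a1 : 0 < ‖u + 10 * I‖ := norm_pos_iff.2 h1
  rw [div_eq_mul_inv, mul_inv, ← inv_pow, ← inv_pow]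
  nlinarith [sq_nonneg (‖u‖⁻¹ - ‖u + 10 * I‖⁻¹)]

lemma hasDerivAt_cauchyKernel {u : ℂ} (h0 : u ≠ 0) (h1 : u + 10 * I ≠ 0) :
    HasDerivAt cauchyKernel (-1 / u ^ 2 + 1 / (u + 10 * I) ^ 2) u := by
  have e : cauchyKernel = fun u : ℂ => u⁻¹ - (u + 10 * I)⁻¹ := by
    funext u; simp [cauchyKernel]
  rw [e]
  have h := (hasDerivAt_inv h0).sub (((hasDerivAt_id u).add_const (10 * I)).inv h1)
  refine HasDerivAt.congr_deriv h ?_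
  simp only [id]
  ring

lemma norm_deriv_cauchyKernel_le (u : ℂ) :
    ‖-1 / u ^ 2 + 1 / (u + 10 * I) ^ 2‖ ≤ kernelMajorant u := by
  refine (norm_add_le _ _).trans ?_
  simp [kernelMajorant]

lemma inv_norm_sq_le_of_near {u v : ℂ} {c : ℝ} (hc : 0 < c) (hu : c ≤ ‖u‖)
    (huv : ‖v - u‖ ≤ c / 2) : (‖v‖ ^ 2)⁻¹ ≤ 4 * (‖u‖ ^ 2)⁻¹ := by
  have h : ‖u‖ / 2 ≤ ‖v‖ := by
    have := norm_sub_norm_le u v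
    rw [norm_sub_rev] at this
    linarith
  have hp : 0 < ‖u‖ := hc.trans_le hu
  calc (‖v‖ ^ 2)⁻¹ ≤ ((‖u‖ / 2) ^ 2)⁻¹ := by gcongr
    _ = 4 * (‖u‖ ^ 2)⁻¹ := by field_simp; norm_num

/-- The Cauchy-type transform of a function on the line `Im = β`. -/
def lineTransform (Φ : ℝ → ℂ) (β : ℝ) (s : ℂ) : ℂ :=
  ∫ t : ℝ, Φ t * cauchyKernel (t + (β * I - s))

lemma lineTransform_bounds {Φ : ℝ → ℂ} {M β c : ℝ} (hΦ : Continuous Φ) (hM : ∀ t, ‖Φ t‖ ≤ M)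
    {s : ℂ} (hc : 0 < c) (hc1 : c ≤ 1) (h1 : c ≤ |β - s.im|) (h2 : c ≤ |β - s.im + 10|) :
    DifferentiableAt ℂ (lineTransform Φ β) s ∧ ‖lineTransform Φ β s‖ ≤ 10 * M * Real.pi / c ^ 2 ∧
      ‖deriv (lineTransform Φ β) s‖ ≤ 10 * M * Real.pi / c ^ 2 := by
  have hM0 : 0 ≤ M := (norm_nonneg _).trans (hM 0)
  have him : ∀ z : ℂ, ((β : ℂ) * I - z).im = β - z.im := fun z => by simp
  have him' : ∀ z : ℂ, ((β : ℂ) * I - z + 10 * I).im = β - z.im + 10 := fun z => by simp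
  have near : ∀ z ∈ ball s (c / 2), c / 2 ≤ |β - z.im| ∧ c / 2 ≤ |β - z.im + 10| := by
    intro z hz
    have hz' : |s.im - z.im| ≤ c / 2 := by
      rw [← Complex.sub_im]
      refine (Complex.abs_im_le_norm _).trans ?_
      rw [← dist_eq_norm, dist_comm]; exact (mem_ball.1 hz).le
    constructor
    · have := abs_sub_abs_le_abs_sub (β - s.im) (β - z.im)
      have e : (β - s.im) - (β - z.im) = -(s.im - z.im) := by ring
      rw [e, abs_neg] at this
      linarith
    · have := abs_sub_abs_le_abs_sub (β - s.im + 10) (β - z.im + 10)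
      have e : (β - s.im + 10) - (β - z.im + 10) = -(s.im - z.im) := by ring
      rw [e, abs_neg] at this
      linarith
  have ne0 : ∀ z ∈ ball s (c / 2), ∀ t : ℝ, (t : ℂ) + (β * I - z) ≠ 0 := fun z hz t => by
    apply ofReal_add_ne_zero
    rw [him]; exact abs_pos.1 ((half_pos hc).trans_le (near z hz).1)
  have ne1 : ∀ z ∈ ball s (c / 2), ∀ t : ℝ, (t : ℂ) + (β * I - z) + 10 * I ≠ 0 :=
    fun z hz t => by
      rw [add_assoc]
      apply ofReal_add_ne_zero
      rw [him']; exact abs_pos.1 ((half_pos hc).trans_le (near z hz).2)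
  have hs : s ∈ ball s (c / 2) := mem_ball_self (half_pos hc)
  have cont : ∀ z ∈ ball s (c / 2),
      Continuous fun t : ℝ => Φ t * cauchyKernel (t + (β * I - z)) := by
    intro z hz
    unfold cauchyKernel
    have a := ne0 z hz
    have b := ne1 z hz
    apply hΦ.mul
    apply Continuous.sub
    · exact continuous_const.div (by fun_prop) a
    · exact continuous_const.div (by fun_prop) b
  have contd : Continuous fun t : ℝ =>
      Φ t * -(-1 / ((t : ℂ) + (β * I - s)) ^ 2 + 1 / (t + (β * I - s) + 10 * I) ^ 2) := by
    have a := ne0 s hs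
    have b := ne1 s hs
    apply hΦ.mul
    apply Continuous.neg
    apply Continuous.add
    · exact continuous_const.div (by fun_prop) fun t => pow_ne_zero _ (a t)
    · exact continuous_const.div (by fun_prop) fun t => pow_ne_zero _ (b t)
  have imaj : Integrable fun t : ℝ => kernelMajorant (t + (β * I - s)) := by
    unfold kernelMajorant
    apply Integrable.add
    · apply integrable_inv_norm_sq
      rw [him]; exact abs_pos.1 (hc.trans_le h1)
    · simp_rw [add_assoc]
      apply integrable_inv_norm_sq
      rw [him']; exact abs_pos.1 (hc.trans_le h2)
  have intmaj : ∫ t : ℝ, kernelMajorant (t + (β * I - s)) ≤ 2 * Real.pi / c ^ 2 := by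
    unfold kernelMajorant
    rw [integral_add]
    · have e1 := integral_inv_norm_sq_le hc hc1 (a := β * I - s) (by rw [him]; exact h1)
      have e2 := integral_inv_norm_sq_le hc hc1 (a := β * I - s + 10 * I)
        (by rw [him']; exact h2)
      simp_rw [← add_assoc] at e2
      calc _ ≤ _ := add_le_add e1 e2
        _ = _ := by ring
    · apply integrable_inv_norm_sq
      rw [him]; exact abs_pos.1 (hc.trans_le h1)
    · simp_rw [add_assoc]
      apply integrable_inv_norm_sq
      rw [him']; exact abs_pos.1 (hc.trans_le h2)
  have maj0 : ∀ u, 0 ≤ kernelMajorant u := fun u => by unfold kernelMajorant; positivity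
  have nearmaj : ∀ z ∈ ball s (c / 2), ∀ t : ℝ,
      kernelMajorant (t + (β * I - z)) ≤ 4 * kernelMajorant (t + (β * I - s)) := by
    intro z hz t
    unfold kernelMajorant
    rw [mul_add]
    have d : ‖s - z‖ ≤ c / 2 := by
      rw [← dist_eq_norm, dist_comm]; exact (mem_ball.1 hz).le
    apply add_le_add
    · apply inv_norm_sq_le_of_near hc
      · refine le_trans ?_ (Complex.abs_im_le_norm _)
        simpa using h1
      · convert d using 2; ring
    · apply inv_norm_sq_le_of_near hc
      · refine le_trans ?_ (Complex.abs_im_le_norm _)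
        simpa using h2
      · convert d using 2; ring
  have key := hasDerivAt_integral_of_dominated_loc_of_deriv_le (𝕜 := ℂ)
    (μ := (volume : Measure ℝ))
    (F := fun z (t : ℝ) => Φ t * cauchyKernel (t + (β * I - z))) (x₀ := s)
    (s := ball s (c / 2))
    (F' := fun z (t : ℝ) =>
      Φ t * -(-1 / ((t : ℂ) + (β * I - z)) ^ 2 + 1 / (t + (β * I - z) + 10 * I) ^ 2))
    (bound := fun t => M * (4 * kernelMajorant (t + (β * I - s))))
    (ball_mem_nhds s (half_pos hc))
    (by filter_upwards [ball_mem_nhds s (half_pos hc)] with z hz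
        exact (cont z hz).aestronglyMeasurable)
    (by
      refine (imaj.const_mul (M * 5)).mono' (cont s hs).aestronglyMeasurable
        (Eventually.of_forall fun t => ?_)
      rw [norm_mul, mul_assoc]
      exact mul_le_mul (hM t) (norm_cauchyKernel_le (ne0 s hs t) (ne1 s hs t))
        (norm_nonneg _) hM0)
    contd.aestronglyMeasurable
    (Eventually.of_forall fun t z hz => by
      rw [norm_mul, norm_neg]
      exact mul_le_mul (hM t) ((norm_deriv_cauchyKernel_le _).trans (nearmaj z hz t))
        (norm_nonneg _) hM0)
    ((imaj.const_mul 4).const_mul M)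
    (Eventually.of_forall fun t z hz => by
      have h := (hasDerivAt_cauchyKernel (ne0 z hz t) (ne1 z hz t))
      have g : HasDerivAt (fun z : ℂ => (t : ℂ) + (β * I - z)) (-1) z := by
        simpa using ((hasDerivAt_id z).const_sub (β * I)).const_add (t : ℂ)
      have := (h.comp z g).const_mul (Φ t)
      exact HasDerivAt.congr_deriv this (by ring))
  refine ⟨key.2.differentiableAt, ?_, ?_⟩
  · refine (norm_integral_le_of_norm_le (imaj.const_mul (M * 5))
      (Eventually.of_forall fun t => ?_)).trans ?_
    · rw [norm_mul, mul_assoc]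
      exact mul_le_mul (hM t) (norm_cauchyKernel_le (ne0 s hs t) (ne1 s hs t))
        (norm_nonneg _) hM0
    · rw [integral_const_mul]
      calc _ ≤ M * 5 * (2 * Real.pi / c ^ 2) := by gcongr
        _ = _ := by ring
  · have e : deriv (lineTransform Φ β) s = _ := key.2.deriv
    rw [e]
    refine (norm_integral_le_of_norm_le (imaj.const_mul (M * 5))
      (Eventually.of_forall fun t => ?_)).trans ?_
    · rw [norm_mul, norm_neg, mul_assoc]
      refine mul_le_mul (hM t) ((norm_deriv_cauchyKernel_le _).trans ?_)
        (norm_nonneg _) hM0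
      linarith [maj0 ((t : ℂ) + (β * I - s))]
    · rw [integral_const_mul]
      calc _ ≤ M * 5 * (2 * Real.pi / c ^ 2) := by gcongr
        _ = _ := by ring

/-- Horizontal contour shift for functions decaying in a closed strip. -/
lemma integral_line_eq {Φ : ℂ → ℂ} {y₁ y₂ C T₀ : ℝ} (hy : y₁ ≤ y₂)
    (hd : ∀ u : ℂ, y₁ ≤ u.im → u.im ≤ y₂ → DifferentiableAt ℂ Φ u)
    (hC : ∀ u : ℂ, y₁ ≤ u.im → u.im ≤ y₂ → T₀ ≤ |u.re| → ‖Φ u‖ ≤ C / |u.re|)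
    (i₁ : Integrable fun t : ℝ => Φ (t + y₁ * I)) (i₂ : Integrable fun t : ℝ => Φ (t + y₂ * I)) :
    ∫ t : ℝ, Φ (t + y₁ * I) = ∫ t : ℝ, Φ (t + y₂ * I) := by
  have t₁ := intervalIntegral_tendsto_integral i₁ tendsto_neg_atTop_atBot tendsto_id
  have t₂ := intervalIntegral_tendsto_integral i₂ tendsto_neg_atTop_atBot tendsto_id
  have hdiff := t₁.sub t₂
  rw [← sub_eq_zero]
  refine tendsto_nhds_unique hdiff ?_
  have hz : Tendsto (fun T : ℝ => 2 * (C * (y₂ - y₁)) / T) atTop (𝓝 0) :=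
    tendsto_const_nhds.div_atTop tendsto_id
  refine squeeze_zero_norm' ?_ hz
  filter_upwards [eventually_ge_atTop T₀, eventually_gt_atTop 0] with T hT hT0
  have rect := Complex.integral_boundary_rect_eq_zero_of_differentiableOn Φ
    ⟨-T, y₁⟩ ⟨T, y₂⟩ (by
      intro u hu
      rw [Complex.mem_reProdIm] at hu
      have := hu.2
      simp only [uIcc_of_le hy] at this
      exact (hd u this.1 this.2).differentiableWithinAt)
  simp only [smul_eq_mul] at rect
  have side : ∀ x : ℝ, |x| = T → ‖∫ y in y₁..y₂, Φ (x + y * I)‖ ≤ C / T * (y₂ - y₁) := by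
    intro x hx
    have := intervalIntegral.norm_integral_le_of_norm_le_const (a := y₁) (b := y₂) (C := C / T)
      (f := fun y : ℝ => Φ (x + y * I)) (fun y hy' => by
        rw [uIoc_of_le hy] at hy'
        have := hC (x + y * I) (by simpa using hy'.1.le) (by simpa using hy'.2)
          (by simpa [hx] using hT)
        simpa [hx] using this)
    rwa [abs_of_nonneg (sub_nonneg.2 hy)] at this
  have s₁ := side T (abs_of_pos hT0)
  have s₂ := side (-T) (by rw [abs_neg, abs_of_pos hT0])
  have e : (∫ t in -T..T, Φ (t + y₁ * I)) - (∫ t in -T..T, Φ (t + y₂ * I)) =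
      I * (∫ y in y₁..y₂, Φ (((-T : ℝ) : ℂ) + y * I)) - I * ∫ y in y₁..y₂, Φ ((T : ℂ) + y * I) := by
    linear_combination rect
  simp only [id]
  rw [e]
  refine (norm_sub_le _ _).trans ?_
  rw [norm_mul, norm_mul, Complex.norm_I, one_mul, one_mul]
  calc _ ≤ _ := add_le_add s₂ s₁
    _ = _ := by ring

lemma continuous_cauchyKernel_line {a : ℂ} (h0 : a.im ≠ 0) (h1 : a.im + 10 ≠ 0) :
    Continuous fun t : ℝ => cauchyKernel (t + a) := by
  unfold cauchyKernel
  apply Continuous.sub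
  · exact continuous_const.div (by fun_prop) (ofReal_add_ne_zero h0)
  · refine continuous_const.div (by fun_prop) fun t => ?_
    rw [add_assoc]
    exact ofReal_add_ne_zero (by simpa using h1) t

lemma integrable_mul_cauchyKernel {a : ℂ} (h0 : a.im ≠ 0) (h1 : a.im + 10 ≠ 0) {Φ : ℝ → ℂ}
    (hΦ : Continuous Φ) {M : ℝ} (hM : ∀ t, ‖Φ t‖ ≤ M) :
    Integrable fun t : ℝ => Φ t * cauchyKernel (t + a) := by
  have h1' : (a + 10 * I).im ≠ 0 := by simpa using h1
  have imaj := ((integrable_inv_norm_sq h0).add (integrable_inv_norm_sq h1')).const_mul (M * 5)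
  refine imaj.mono' (hΦ.mul (continuous_cauchyKernel_line h0 h1)).aestronglyMeasurable
    (Eventually.of_forall fun t => ?_)
  rw [norm_mul, mul_assoc]
  refine mul_le_mul (hM t) ?_ (norm_nonneg _) ((norm_nonneg _).trans (hM 0))
  have := norm_cauchyKernel_le (ofReal_add_ne_zero h0 t)
    (by rw [add_assoc]; exact ofReal_add_ne_zero h1' t)
  simpa [kernelMajorant, add_assoc] using this

lemma integrable_cauchyKernel {a : ℂ} (h0 : a.im ≠ 0) (h1 : a.im + 10 ≠ 0) :
    Integrable fun t : ℝ => cauchyKernel (t + a) := by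
  simpa using integrable_mul_cauchyKernel h0 h1 (Φ := fun _ => 1) continuous_const (M := 1)
    (fun _ => by simp)

lemma norm_cauchyKernel_le_re {u : ℂ} (h : u.re ≠ 0) : ‖cauchyKernel u‖ ≤ 10 / u.re ^ 2 := by
  have h0 : u ≠ 0 := fun e => h (by simp [e])
  have h1 : u + 10 * I ≠ 0 := fun e => h (by simpa using congrArg Complex.re e)
  refine (norm_cauchyKernel_le h0 h1).trans ?_
  have hp : 0 < u.re ^ 2 := by positivity
  have a : (‖u‖ ^ 2)⁻¹ ≤ (u.re ^ 2)⁻¹ := by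
    apply inv_anti₀ hp
    rw [← sq_abs u.re]
    gcongr
    exact Complex.abs_re_le_norm u
  have b : (‖u + 10 * I‖ ^ 2)⁻¹ ≤ (u.re ^ 2)⁻¹ := by
    apply inv_anti₀ hp
    rw [← sq_abs u.re]
    gcongr
    simpa using Complex.abs_re_le_norm (u + 10 * I)
  unfold kernelMajorant
  rw [div_eq_mul_inv]
  linarith

lemma integral_cauchyKernel_shift {y₁ y₂ : ℝ} (hy : y₁ ≤ y₂)
    (h0 : 0 < y₁ ∨ (-10 < y₁ ∧ y₂ < 0)) :
    ∫ t : ℝ, cauchyKernel (t + y₁ * I) = ∫ t : ℝ, cauchyKernel (t + y₂ * I) := by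
  have ne : ∀ y, y₁ ≤ y → y ≤ y₂ → y ≠ 0 ∧ y + 10 ≠ 0 := by
    intro y h h'
    rcases h0 with h0 | h0
    · exact ⟨by linarith, by linarith⟩
    · exact ⟨by linarith, by linarith⟩
  refine integral_line_eq (C := 10) (T₀ := 1) hy ?_ ?_ ?_ ?_
  · intro u hu hu'
    obtain ⟨a, b⟩ := ne _ hu hu'
    refine (hasDerivAt_cauchyKernel ?_ ?_).differentiableAt
    · intro e; exact a (by simp [e])
    · intro e; exact b (by simpa using congrArg Complex.im e)
  · intro u _ _ hT
    have hr : u.re ≠ 0 := abs_pos.1 (by linarith)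
    refine (norm_cauchyKernel_le_re hr).trans ?_
    rw [← sq_abs]
    apply div_le_div_of_nonneg_left (by norm_num) (by linarith)
    nlinarith
  · obtain ⟨a, b⟩ := ne _ le_rfl hy
    exact integrable_cauchyKernel (by simpa using a) (by simpa using b)
  · obtain ⟨a, b⟩ := ne _ hy le_rfl
    exact integrable_cauchyKernel (by simpa using a) (by simpa using b)

lemma integral_cauchyKernel_eq_of_pos {a : ℂ} (ha : 0 < a.im) :
    ∫ t : ℝ, cauchyKernel (t + a) = ∫ t : ℝ, cauchyKernel (t + (5 : ℝ) * I) := by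
  have h : ∫ t : ℝ, cauchyKernel (t + a) = ∫ t : ℝ, cauchyKernel (t + a.im * I) := by
    rw [← integral_add_right_eq_self (fun t : ℝ => cauchyKernel (t + a.im * I)) a.re]
    congr 1; funext t; congr 1
    push_cast
    rw [add_assoc, Complex.re_add_im]
  rw [h]
  rcases le_total a.im 5 with h5 | h5
  · exact integral_cauchyKernel_shift h5 (Or.inl ha)
  · exact (integral_cauchyKernel_shift h5 (Or.inl (by norm_num))).symm

lemma integral_cauchyKernel_eq_of_neg {a : ℂ} (ha : a.im < 0) (ha' : -10 < a.im) :
    ∫ t : ℝ, cauchyKernel (t + a) = ∫ t : ℝ, cauchyKernel (t + (-5 : ℝ) * I) := by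
  have h : ∫ t : ℝ, cauchyKernel (t + a) = ∫ t : ℝ, cauchyKernel (t + a.im * I) := by
    rw [← integral_add_right_eq_self (fun t : ℝ => cauchyKernel (t + a.im * I)) a.re]
    congr 1; funext t; congr 1
    push_cast
    rw [add_assoc, Complex.re_add_im]
  rw [h]
  rcases le_total a.im (-5) with h5 | h5
  · exact integral_cauchyKernel_shift h5 (Or.inr ⟨ha', by norm_num⟩)
  · exact (integral_cauchyKernel_shift h5 (Or.inr ⟨by norm_num, ha⟩)).symm

/-- The jump of the transform of the constant function `1`. -/
def kernelJump : ℂ :=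
  (∫ t : ℝ, cauchyKernel (t + (-5 : ℝ) * I)) - ∫ t : ℝ, cauchyKernel (t + (5 : ℝ) * I)

lemma kernelJump_ne_zero : kernelJump ≠ 0 := by
  have i₁ : Integrable fun t : ℝ => cauchyKernel (t + (-5 : ℝ) * I) :=
    integrable_cauchyKernel (by simp) (by simp; norm_num)
  have i₂ : Integrable fun t : ℝ => cauchyKernel (t + (5 : ℝ) * I) :=
    integrable_cauchyKernel (by simp) (by simp; norm_num)
  have him : ∀ t : ℝ, (cauchyKernel (t + (-5 : ℝ) * I) - cauchyKernel (t + (5 : ℝ) * I)).im =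
      15 * (t ^ 2 + 25)⁻¹ - 15 * (t ^ 2 + 225)⁻¹ := by
    intro t
    have e1 : ((t : ℂ) + ((-5 : ℝ) : ℂ) * I + 10 * I) = t + (5 : ℝ) * I := by push_cast; ring
    have e2 : ((t : ℂ) + ((5 : ℝ) : ℂ) * I + 10 * I) = t + (15 : ℝ) * I := by push_cast; ring
    have inv_im : ∀ y : ℝ, (1 / ((t : ℂ) + (y : ℂ) * I)).im = -y / (t ^ 2 + y ^ 2) := by
      intro y
      rw [one_div, Complex.inv_im, Complex.normSq_apply]
      simp
      ring
    simp only [cauchyKernel, e1, e2, Complex.sub_im, inv_im]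
    norm_num
    ring
  have hpos : ∀ t : ℝ, 0 < 15 * (t ^ 2 + 25)⁻¹ - 15 * (t ^ 2 + 225)⁻¹ := by
    intro t
    have : (t ^ 2 + 225)⁻¹ < (t ^ 2 + 25)⁻¹ := inv_strictAnti₀ (by positivity) (by linarith)
    linarith
  have hi : Integrable fun t : ℝ => 15 * (t ^ 2 + 25)⁻¹ - 15 * (t ^ 2 + 225)⁻¹ := by
    simp_rw [← him]
    exact Complex.imCLM.integrable_comp (i₁.sub i₂)
  intro h0
  have h1 : kernelJump.im = ∫ t : ℝ, (15 * (t ^ 2 + 25)⁻¹ - 15 * (t ^ 2 + 225)⁻¹) := by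
    unfold kernelJump
    rw [← integral_sub i₁ i₂]
    have := Complex.imCLM.integral_comp_comm (i₁.sub i₂)
    simp only [Complex.imCLM_apply, Pi.sub_apply] at this
    rw [← this]
    simp_rw [him]
  rw [h0, Complex.zero_im] at h1
  have h2 := (integral_pos_iff_support_of_nonneg (fun t => (hpos t).le) hi).2 (by
    have : Function.support (fun t : ℝ => 15 * (t ^ 2 + 25)⁻¹ - 15 * (t ^ 2 + 225)⁻¹) = univ := by
      ext t; simp only [Function.mem_support, mem_univ, iff_true]; exact (hpos t).ne'
    rw [this]; simp)
  exact h2.ne h1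

lemma lineTransform_sub {F : ℂ → ℂ} {M : ℝ}
    (hF : ∀ u : ℂ, 0 < u.im → u.im < 3 / 2 → DifferentiableAt ℂ F u)
    (hM : ∀ u : ℂ, 0 < u.im → u.im < 3 / 2 → ‖F u‖ ≤ M)
    {s : ℂ} (h1 : 1 / 2 < s.im) (h2 : s.im < 1) :
    lineTransform (fun t => F (t + (1 / 2 : ℝ) * I)) (1 / 2) s -
      lineTransform (fun t => F (t + (1 : ℝ) * I)) 1 s = F s * kernelJump := by
  have cont : ∀ y : ℝ, 0 < y → y < 3 / 2 → Continuous fun t : ℝ => F (t + y * I) := by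
    intro y hy hy'
    rw [continuous_iff_continuousAt]
    intro t
    have := (hF (t + y * I) (by simpa using hy) (by simpa using hy')).continuousAt
    exact ContinuousAt.comp (f := fun t : ℝ => (t : ℂ) + y * I) this (by fun_prop)
  have int1 : ∀ y : ℝ, 0 < y → y < 3 / 2 → y ≠ s.im →
      Integrable fun t : ℝ => F (t + y * I) * cauchyKernel (t + (y * I - s)) := by
    intro y hy hy' hys
    refine integrable_mul_cauchyKernel ?_ ?_ (cont y hy hy')
      (fun t => hM _ (by simpa using hy) (by simpa using hy'))
    · simpa using sub_ne_zero.2 hys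
    · simp; linarith
  have int2 : ∀ y : ℝ, 0 < y → y < 3 / 2 → y ≠ s.im →
      Integrable fun t : ℝ => F s * cauchyKernel (t + (y * I - s)) := by
    intro y hy hy' hys
    refine (integrable_cauchyKernel ?_ ?_).const_mul _
    · simpa using sub_ne_zero.2 hys
    · simp; linarith
  have hs : {u : ℂ | 0 < u.im ∧ u.im < 3 / 2} ∈ 𝓝 s := by
    apply IsOpen.mem_nhds
    · exact (isOpen_lt continuous_const Complex.continuous_im).inter
        (isOpen_lt Complex.continuous_im continuous_const)
    · exact ⟨by linarith, by linarith⟩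
  have hds : DifferentiableOn ℂ (dslope F s) {u : ℂ | 0 < u.im ∧ u.im < 3 / 2} :=
    (Complex.differentiableOn_dslope hs).2
      fun u hu => (hF u hu.1 hu.2).differentiableWithinAt
  have hden : ∀ u : ℂ, 1 / 2 ≤ u.im → u - s + 10 * I ≠ 0 := by
    intro u hu e
    have := congrArg Complex.im e
    simp at this
    linarith
  have heq : ∀ u : ℂ, u ≠ s → 1 / 2 ≤ u.im → dslope F s u * (10 * I / (u - s + 10 * I)) =
      (F u - F s) * cauchyKernel (u - s) := by
    intro u hus hu
    rw [dslope_of_ne _ hus, slope_def_field, cauchyKernel]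
    have := hden u hu
    have := sub_ne_zero.2 hus
    field_simp
    ring
  have heq' : ∀ y : ℝ, y ≠ s.im → 1 / 2 ≤ y → (fun t : ℝ =>
      dslope F s (t + y * I) * (10 * I / (t + y * I - s + 10 * I))) = fun t : ℝ =>
      F (t + y * I) * cauchyKernel (t + (y * I - s)) - F s * cauchyKernel (t + (y * I - s)) := by
    intro y hys hy
    funext t
    rw [heq _ ?_ (by simpa using hy), add_sub_assoc, sub_mul]
    intro e; exact hys (by simpa using congrArg Complex.im e)
  have shift := integral_line_eq
    (Φ := fun u => dslope F s u * (10 * I / (u - s + 10 * I))) (y₁ := (1 / 2 : ℝ)) (y₂ := 1)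
    (C := 80 * M) (T₀ := 2 * |s.re| + 1) (by norm_num)
    (by
      intro u hu hu'
      refine DifferentiableAt.mul ?_ ?_
      · refine hds.differentiableAt (IsOpen.mem_nhds ?_ ⟨by linarith, by linarith⟩)
        exact (isOpen_lt continuous_const Complex.continuous_im).inter
          (isOpen_lt Complex.continuous_im continuous_const)
      · exact (differentiableAt_const _).div (by fun_prop) (hden u hu))
    (by
      intro u hu hu' hT
      have hr : |u.re| / 2 + 1 / 2 ≤ |(u - s).re| := by
        have := abs_sub_abs_le_abs_sub u.re s.re
        rw [Complex.sub_re]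
        linarith
      have hr0 : (u - s).re ≠ 0 := abs_pos.1 (by have := abs_nonneg u.re; linarith)
      have hus : u ≠ s := by rintro rfl; simp at hr0
      rw [heq u hus hu, norm_mul]
      have hb : ‖F u - F s‖ ≤ 2 * M := by
        refine (norm_sub_le _ _).trans ?_
        have := hM u (by linarith) (by linarith)
        have := hM s (by linarith) (by linarith)
        linarith
      have hup : 0 < |u.re| := by have := abs_nonneg s.re; linarith
      have hk : ‖cauchyKernel (u - s)‖ ≤ 40 / |u.re| := by
        refine (norm_cauchyKernel_le_re hr0).trans ?_
        rw [← sq_abs, div_le_div_iff₀ (by positivity) hup]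
        nlinarith
      calc _ ≤ 2 * M * (40 / |u.re|) :=
            mul_le_mul hb hk (norm_nonneg _) ((norm_nonneg _).trans hb)
        _ = _ := by ring)
    (by
      rw [heq' _ (by linarith) le_rfl]
      exact (int1 _ (by norm_num) (by norm_num) (by linarith)).sub
        (int2 _ (by norm_num) (by norm_num) (by linarith)))
    (by
      rw [heq' _ (by linarith) (by norm_num)]
      exact (int1 _ (by norm_num) (by norm_num) (by linarith)).sub
        (int2 _ (by norm_num) (by norm_num) (by linarith)))
  rw [heq' _ (by linarith) le_rfl, heq' _ (by linarith) (by norm_num),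
    integral_sub (int1 _ (by norm_num) (by norm_num) (by linarith))
      (int2 _ (by norm_num) (by norm_num) (by linarith)),
    integral_sub (int1 _ (by norm_num) (by norm_num) (by linarith))
      (int2 _ (by norm_num) (by norm_num) (by linarith)),
    integral_const_mul, integral_const_mul,
    integral_cauchyKernel_eq_of_neg (by simp; linarith) (by simp; linarith),
    integral_cauchyKernel_eq_of_pos (a := (1 : ℝ) * I - s) (by simp; linarith)] at shift
  unfold lineTransform kernelJump
  linear_combination shift

/-- Additive splitting of a bounded holomorphic function on a strip. -/
lemma exists_strip_splitting {F : ℂ → ℂ} {M : ℝ}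
    (hF : ∀ u : ℂ, 0 < u.im → u.im < 3 / 2 → DifferentiableAt ℂ F u)
    (hM : ∀ u : ℂ, 0 < u.im → u.im < 3 / 2 → ‖F u‖ ≤ M) :
    ∃ (A B : ℂ → ℂ) (C : ℝ),
      (∀ s : ℂ, 1 / 2 < s.im → s.im < 1 → F s = A s - B s) ∧
      (∀ s : ℂ, 1 / 2 < s.im → s.im < 4 → DifferentiableAt ℂ A s) ∧
      (∀ s : ℂ, s.im < 1 → DifferentiableAt ℂ B s) ∧
      (∀ s : ℂ, 3 / 4 ≤ s.im → s.im < 4 → ‖A s‖ ≤ C ∧ ‖deriv A s‖ ≤ C) ∧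
      (∀ s : ℂ, s.im ≤ 3 / 4 → ‖B s‖ ≤ C ∧ ‖deriv B s‖ ≤ C) ∧ B 0 = 0 := by
  have cont : ∀ y : ℝ, 0 < y → y < 3 / 2 → Continuous fun t : ℝ => F (t + y * I) := by
    intro y hy hy'
    rw [continuous_iff_continuousAt]
    intro t
    have := (hF (t + y * I) (by simpa using hy) (by simpa using hy')).continuousAt
    exact ContinuousAt.comp (f := fun t : ℝ => (t : ℂ) + y * I) this (by fun_prop)
  have bd : ∀ y : ℝ, 0 < y → y < 3 / 2 → ∀ t : ℝ, ‖F (t + y * I)‖ ≤ M := fun y hy hy' t =>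
    hM _ (by simpa using hy) (by simpa using hy')
  set P := lineTransform (fun t => F (t + (1 / 2 : ℝ) * I)) (1 / 2) with hP
  set R := lineTransform (fun t => F (t + (1 : ℝ) * I)) 1 with hR
  have hPb : ∀ {s : ℂ} {c : ℝ}, 0 < c → c ≤ 1 → 1 / 2 + c ≤ s.im → s.im < 4 → _ :=
    fun {s c} hc hc1 h h' => lineTransform_bounds (β := 1 / 2) (cont (1 / 2) (by norm_num) (by norm_num))
      (bd (1 / 2) (by norm_num) (by norm_num)) (s := s) hc hc1
      (by rw [abs_sub_comm]; exact le_trans (by linarith) (le_abs_self _))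
      (by exact le_trans (by linarith) (le_abs_self _))
  have hRb : ∀ {s : ℂ} {c : ℝ}, 0 < c → c ≤ 1 → s.im + c ≤ 1 → _ :=
    fun {s c} hc hc1 h => lineTransform_bounds (β := 1) (cont 1 (by norm_num) (by norm_num))
      (bd 1 (by norm_num) (by norm_num)) (s := s) hc hc1
      (by exact le_trans (by linarith) (le_abs_self _))
      (by exact le_trans (by linarith) (le_abs_self _))
  have hJ := kernelJump_ne_zero
  set D := 10 * M * Real.pi / (1 / 4) ^ 2 with hD
  have hR0 : ‖R 0‖ ≤ D := (hRb (s := 0) (c := 1 / 4) (by norm_num) (by norm_num)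
    (by simp; norm_num)).2.1
  have hD0 : 0 ≤ D := (norm_nonneg _).trans hR0
  have hPd : ∀ s : ℂ, 1 / 2 < s.im → s.im < 4 → DifferentiableAt ℂ P s := fun s h h' =>
    (hPb (c := min 1 (s.im - 1 / 2)) (lt_min one_pos (by linarith)) (min_le_left _ _)
      (by have := min_le_right 1 (s.im - 1 / 2); linarith) h').1
  have hRd : ∀ s : ℂ, s.im < 1 → DifferentiableAt ℂ R s := fun s h =>
    (hRb (c := min 1 (1 - s.im)) (lt_min one_pos (by linarith)) (min_le_left _ _)
      (by have := min_le_right 1 (1 - s.im); linarith)).1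
  refine ⟨fun s => (P s - R 0) / kernelJump, fun s => (R s - R 0) / kernelJump,
    2 * D / ‖kernelJump‖, ?_, ?_, ?_, ?_, ?_, ?_⟩
  · intro s h h'
    have := lineTransform_sub hF hM h h'
    rw [← hP, ← hR] at this
    field_simp
    linear_combination -this
  · intro s h h'
    exact ((hPd s h h').sub_const _).div_const _
  · intro s h
    exact ((hRd s h).sub_const _).div_const _
  · intro s h h'
    have b := hPb (s := s) (c := 1 / 4) (by norm_num) (by norm_num) (by linarith) h'
    rw [deriv_div_const, deriv_sub_const, norm_div, norm_div]
    constructor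
    · gcongr
      refine (norm_sub_le _ _).trans ?_
      linarith [b.2.1]
    · gcongr
      linarith [b.2.2]
  · intro s h
    have b := hRb (s := s) (c := 1 / 4) (by norm_num) (by norm_num) (by linarith)
    rw [deriv_div_const, deriv_sub_const, norm_div, norm_div]
    constructor
    · gcongr
      refine (norm_sub_le _ _).trans ?_
      linarith [b.2.1]
    · gcongr
      linarith [b.2.2]
  · simp

lemma isOpen_disc : IsOpen disc := isOpen_ball

lemma mem_disc {z : ℂ} : z ∈ disc ↔ ‖z‖ < 1 := by simp [disc]

lemma poisson_kernel_le {z ζ : ℂ} (hz : ‖z‖ < 1) (hζ : ‖ζ‖ = 1) :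
    0 ≤ (1 - ‖z‖ ^ 2) / ‖1 - (starRingEnd ℂ) ζ * z‖ ^ 2 ∧
      (1 - ‖z‖ ^ 2) / ‖1 - (starRingEnd ℂ) ζ * z‖ ^ 2 ≤ 2 * ‖z - ζ‖⁻¹ := by
  have e : ‖1 - (starRingEnd ℂ) ζ * z‖ = ‖z - ζ‖ := by
    have h1 : (starRingEnd ℂ) ζ * ζ = 1 := by
      rw [← Complex.normSq_eq_conj_mul_self, Complex.normSq_eq_norm_sq, hζ]; simp
    have h2 : 1 - (starRingEnd ℂ) ζ * z = -((starRingEnd ℂ) ζ * (z - ζ)) := by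
      rw [mul_sub, h1]; ring
    rw [h2, norm_neg, norm_mul, Complex.norm_conj, hζ, one_mul]
  rw [e]
  have hd : 1 - ‖z‖ ≤ ‖z - ζ‖ := by
    have := norm_sub_norm_le ζ z
    rw [norm_sub_rev, hζ] at this
    exact this
  have hp : 0 < ‖z - ζ‖ := by linarith
  have h0 := norm_nonneg z
  constructor
  · apply div_nonneg _ (by positivity)
    nlinarith
  · rw [div_le_iff₀ (by positivity)]
    have : 2 * ‖z - ζ‖⁻¹ * ‖z - ζ‖ ^ 2 = 2 * ‖z - ζ‖ := by field_simp
    rw [this]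
    nlinarith

lemma ae_norm_eq_one {μ : Measure ℂ} (hμ : OnCircle μ) : ∀ᵐ ζ ∂μ, ‖ζ‖ = 1 := by
  have : ∀ᵐ ζ ∂μ, ζ ∈ circleT := by
    rw [ae_iff]; exact hμ
  filter_upwards [this] with ζ h
  simpa [circleT] using h

lemma poissonMu_nonneg {μ : Measure ℂ} (hμ : OnCircle μ) {z : ℂ} (hz : z ∈ disc) :
    0 ≤ poissonMu μ z := by
  apply integral_nonneg_of_ae
  filter_upwards [ae_norm_eq_one hμ] with ζ hζ
  exact (poisson_kernel_le (mem_disc.1 hz) hζ).1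

lemma integrableOn_ball_norm_inv :
    IntegrableOn (fun w : ℂ => 2 * ‖w‖⁻¹) (ball 0 2) := by
  refine integrableOn_ball_of_norm_le_rpow (C := 2) (α := 1) (by simp)
    (by simp) (Eventually.of_forall fun w => ?_) (by fun_prop)
  rw [Real.rpow_neg_one, Real.norm_of_nonneg (by positivity)]

lemma integrableOn_disc_norm_inv {ζ : ℂ} (hζ : ‖ζ‖ = 1) :
    IntegrableOn (fun z : ℂ => 2 * ‖z - ζ‖⁻¹) disc ∧
      ∫ z in disc, 2 * ‖z - ζ‖⁻¹ ≤ ∫ w in ball (0 : ℂ) 2, 2 * ‖w‖⁻¹ := by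
  have mp : MeasurePreserving (fun z : ℂ => z - ζ) volume volume :=
    measurePreserving_sub_right volume ζ
  have me : MeasurableEmbedding (fun z : ℂ => z - ζ) :=
    (MeasurableEquiv.subRight ζ).measurableEmbedding
  have sub : disc ⊆ (fun z : ℂ => z - ζ) ⁻¹' ball (0 : ℂ) 2 := by
    intro z hz
    rw [mem_preimage, mem_ball_zero_iff]
    have := norm_sub_le z ζ
    have := mem_disc.1 hz
    linarith
  have i : IntegrableOn (fun z : ℂ => 2 * ‖z - ζ‖⁻¹)
      ((fun z : ℂ => z - ζ) ⁻¹' ball (0 : ℂ) 2) :=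
    (mp.integrableOn_comp_preimage me (f := fun w : ℂ => 2 * ‖w‖⁻¹)).2
      integrableOn_ball_norm_inv
  refine ⟨i.mono_set sub, ?_⟩
  rw [← mp.setIntegral_preimage_emb me (fun w : ℂ => 2 * ‖w‖⁻¹)]
  exact setIntegral_mono_set i (Eventually.of_forall fun z => by positivity)
    (Eventually.of_forall sub)

lemma integrableOn_poissonMu {μ : Measure ℂ} [IsFiniteMeasure μ] (hμ : OnCircle μ) :
    IntegrableOn (poissonMu μ) disc := by
  have hm : Measurable fun p : ℂ × ℂ =>
      (1 - ‖p.1‖ ^ 2) / ‖1 - (starRingEnd ℂ) p.2 * p.1‖ ^ 2 := by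
    have : Measurable fun p : ℂ × ℂ => (starRingEnd ℂ) p.2 :=
      (Complex.continuous_conj.measurable).comp measurable_snd
    fun_prop
  have hslice : ∀ ζ : ℂ, ‖ζ‖ = 1 → ∀ᵐ z ∂(volume.restrict disc),
      ‖(1 - ‖z‖ ^ 2) / ‖1 - (starRingEnd ℂ) ζ * z‖ ^ 2‖ ≤ 2 * ‖z - ζ‖⁻¹ := by
    intro ζ hζ
    filter_upwards [ae_restrict_mem isOpen_disc.measurableSet] with z hz
    have := poisson_kernel_le (mem_disc.1 hz) hζ
    rw [Real.norm_of_nonneg this.1]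
    exact this.2
  have hint : Integrable (fun p : ℂ × ℂ =>
      (1 - ‖p.1‖ ^ 2) / ‖1 - (starRingEnd ℂ) p.2 * p.1‖ ^ 2)
      ((volume.restrict disc).prod μ) := by
    rw [integrable_prod_iff' hm.aestronglyMeasurable]
    constructor
    · filter_upwards [ae_norm_eq_one hμ] with ζ hζ
      exact (integrableOn_disc_norm_inv hζ).1.mono'
        (hm.comp (measurable_id.prodMk measurable_const)).aestronglyMeasurable (hslice ζ hζ)
    · refine Integrable.of_bound
        (hm.norm.stronglyMeasurable.integral_prod_left').aestronglyMeasurable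
        (∫ w in ball (0 : ℂ) 2, 2 * ‖w‖⁻¹) ?_
      filter_upwards [ae_norm_eq_one hμ] with ζ hζ
      rw [Real.norm_of_nonneg (integral_nonneg fun _ => norm_nonneg _)]
      refine le_trans ?_ (integrableOn_disc_norm_inv hζ).2
      exact integral_mono_of_nonneg (Eventually.of_forall fun _ => norm_nonneg _)
        (integrableOn_disc_norm_inv hζ).1 (hslice ζ hζ)
  exact hint.integral_prod_left

/-- Bounded differentiable functions on `S` whose derivative is controlled by `1 + ‖φ‖`. -/
def TameOn (φ : ℂ → ℂ) (S : Set ℂ) (k : ℂ → ℂ) : Prop :=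
  (∀ z ∈ S, DifferentiableAt ℂ k z) ∧
    ∃ C : ℝ, ∀ z ∈ S, ‖k z‖ ≤ C ∧ ‖deriv k z‖ ≤ C * (1 + ‖φ z‖)

namespace TameOn

variable {φ k l : ℂ → ℂ} {S T : Set ℂ}

lemma exists_bound (h : TameOn φ S k) :
    ∃ C : ℝ, 0 ≤ C ∧ ∀ z ∈ S, ‖k z‖ ≤ C ∧ ‖deriv k z‖ ≤ C * (1 + ‖φ z‖) := by
  obtain ⟨_, C, hC⟩ := h
  refine ⟨|C|, abs_nonneg _, fun z hz => ⟨(hC z hz).1.trans (le_abs_self _),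
    (hC z hz).2.trans ?_⟩⟩
  gcongr
  exact le_abs_self _

lemma mono (h : TameOn φ S k) (hT : T ⊆ S) : TameOn φ T k :=
  ⟨fun z hz => h.1 z (hT hz), h.2.imp fun _ hC z hz => hC z (hT hz)⟩

lemma union (h : TameOn φ S k) (h' : TameOn φ T k) : TameOn φ (S ∪ T) k := by
  obtain ⟨C, hC0, hC⟩ := h.exists_bound
  obtain ⟨D, hD0, hD⟩ := h'.exists_bound
  refine ⟨fun z hz => hz.elim (h.1 z) (h'.1 z), C + D, fun z hz => ?_⟩
  have hp : 0 ≤ 1 + ‖φ z‖ := by positivity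
  rcases hz with hz | hz
  · refine ⟨by linarith [(hC z hz).1], (hC z hz).2.trans ?_⟩
    gcongr; linarith
  · refine ⟨by linarith [(hD z hz).1], (hD z hz).2.trans ?_⟩
    gcongr; linarith

lemma congr (h : TameOn φ S k) (e : ∀ z ∈ S, l =ᶠ[𝓝 z] k) : TameOn φ S l := by
  obtain ⟨hd, C, hC⟩ := h
  refine ⟨fun z hz => (e z hz).differentiableAt_iff.2 (hd z hz), C, fun z hz => ?_⟩
  rw [(e z hz).eq_of_nhds, (e z hz).deriv_eq]
  exact hC z hz

lemma congr_of_isOpen (h : TameOn φ S k) (hS : IsOpen S) (e : EqOn l k S) : TameOn φ S l :=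
  h.congr fun z hz => by filter_upwards [hS.mem_nhds hz] with w hw using e hw

lemma of_bounds {C : ℝ} (hd : ∀ z ∈ S, DifferentiableAt ℂ k z)
    (hC : ∀ z ∈ S, ‖k z‖ ≤ C ∧ ‖deriv k z‖ ≤ C) : TameOn φ S k := by
  refine ⟨hd, C, fun z hz => ⟨(hC z hz).1, (hC z hz).2.trans ?_⟩⟩
  have hC0 : 0 ≤ C := (norm_nonneg _).trans (hC z hz).1
  nlinarith [norm_nonneg (φ z)]

lemma const (c : ℂ) : TameOn φ S (fun _ => c) :=
  of_bounds (C := ‖c‖) (fun z _ => differentiableAt_const c) (fun z _ => by simp)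

lemma of_compact {K U : Set ℂ} (hK : IsCompact K) (hU : IsOpen U) (hKU : K ⊆ U)
    (hd : DifferentiableOn ℂ k U) : TameOn φ K k := by
  obtain ⟨C, hC⟩ := hK.exists_bound_of_continuousOn (hd.continuousOn.mono hKU)
  obtain ⟨D, hD⟩ := hK.exists_bound_of_continuousOn ((hd.deriv hU).continuousOn.mono hKU)
  exact of_bounds (C := max C D) (fun z hz => (hd z (hKU hz)).differentiableAt
    (hU.mem_nhds (hKU hz))) fun z hz => ⟨(hC z hz).trans (le_max_left _ _),
    (hD z hz).trans (le_max_right _ _)⟩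

lemma of_differentiable (hk : Differentiable ℂ k) : TameOn φ disc k :=
  (of_compact (isCompact_closedBall (0 : ℂ) 1) isOpen_univ (subset_univ _)
    hk.differentiableOn).mono ball_subset_closedBall

lemma add (h : TameOn φ S k) (h' : TameOn φ S l) : TameOn φ S (fun z => k z + l z) := by
  obtain ⟨C, hC0, hC⟩ := h.exists_bound
  obtain ⟨D, hD0, hD⟩ := h'.exists_bound
  refine ⟨fun z hz => (h.1 z hz).add (h'.1 z hz), C + D, fun z hz => ⟨?_, ?_⟩⟩
  · exact (norm_add_le _ _).trans (add_le_add (hC z hz).1 (hD z hz).1)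
  · have := deriv_fun_add (h.1 z hz) (h'.1 z hz)
    rw [this, add_mul]
    exact (norm_add_le _ _).trans (add_le_add (hC z hz).2 (hD z hz).2)

lemma mul (h : TameOn φ S k) (h' : TameOn φ S l) : TameOn φ S (fun z => k z * l z) := by
  obtain ⟨C, hC0, hC⟩ := h.exists_bound
  obtain ⟨D, hD0, hD⟩ := h'.exists_bound
  refine ⟨fun z hz => (h.1 z hz).mul (h'.1 z hz), 2 * (C * D), fun z hz => ⟨?_, ?_⟩⟩
  · rw [norm_mul]
    have := mul_le_mul (hC z hz).1 (hD z hz).1 (norm_nonneg _) hC0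
    have := mul_nonneg hC0 hD0
    linarith
  · rw [deriv_fun_mul (h.1 z hz) (h'.1 z hz)]
    refine (norm_add_le _ _).trans ?_
    rw [norm_mul, norm_mul]
    have hp : 0 ≤ 1 + ‖φ z‖ := by positivity
    calc _ ≤ C * (1 + ‖φ z‖) * D + C * (D * (1 + ‖φ z‖)) :=
          add_le_add (mul_le_mul (hC z hz).2 (hD z hz).1 (norm_nonneg _) (by positivity))
            (mul_le_mul (hC z hz).1 (hD z hz).2 (norm_nonneg _) hC0)
      _ = _ := by ring

lemma sub (h : TameOn φ S k) (h' : TameOn φ S l) : TameOn φ S (fun z => k z - l z) := by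
  have := h.add ((const (-1)).mul h')
  simpa [sub_eq_add_neg] using this

lemma inv (h : TameOn φ S k) {c : ℝ} (hc : 0 < c) (hk : ∀ z ∈ S, c ≤ ‖k z‖) :
    TameOn φ S (fun z => (k z)⁻¹) := by
  obtain ⟨C, hC0, hC⟩ := h.exists_bound
  have ne : ∀ z ∈ S, k z ≠ 0 := fun z hz => norm_pos_iff.1 (hc.trans_le (hk z hz))
  refine ⟨fun z hz => (h.1 z hz).inv (ne z hz), c⁻¹ + C / c ^ 2, fun z hz => ⟨?_, ?_⟩⟩
  · rw [norm_inv]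
    have := inv_anti₀ hc (hk z hz)
    have : 0 ≤ C / c ^ 2 := by positivity
    linarith
  · rw [deriv_fun_inv'' (h.1 z hz) (ne z hz), norm_div, norm_neg, norm_pow]
    have hp : 0 ≤ 1 + ‖φ z‖ := by positivity
    calc _ ≤ C * (1 + ‖φ z‖) / c ^ 2 :=
          div_le_div₀ (by positivity) (hC z hz).2 (by positivity)
            (pow_le_pow_left₀ hc.le (hk z hz) 2)
      _ = C / c ^ 2 * (1 + ‖φ z‖) := by ring
      _ ≤ _ := by gcongr; linarith [inv_pos.2 hc]

/-- Division by `a - z`: only the behaviour near `a` matters. -/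
lemma of_sub_mul {a : ℂ} {r : ℝ} (hr : 0 < r) (hk : TameOn φ disc k)
    (e : ∀ z ∈ disc, (a - z) * l z = k z) (hl : TameOn φ (disc ∩ ball a r) l) :
    TameOn φ disc l := by
  have hfar : TameOn φ (disc ∩ (closedBall a (r / 2))ᶜ) l := by
    have hop : IsOpen (disc ∩ (closedBall a (r / 2))ᶜ) :=
      isOpen_disc.inter isClosed_closedBall.isOpen_compl
    have hlow : ∀ z ∈ disc ∩ (closedBall a (r / 2))ᶜ, r / 2 ≤ ‖a - z‖ := by
      intro z hz
      have := hz.2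
      rw [mem_compl_iff, mem_closedBall, dist_eq_norm, not_le, norm_sub_rev] at this
      exact this.le
    have hden : TameOn φ disc (fun z => a - z) := of_differentiable (by fun_prop)
    refine ((hk.mono inter_subset_left).mul ((hden.mono inter_subset_left).inv
      (half_pos hr) hlow)).congr_of_isOpen hop fun z hz => ?_
    have : a - z ≠ 0 := norm_pos_iff.1 ((half_pos hr).trans_le (hlow z hz))
    simp only
    rw [← e z hz.1]
    field_simp
  refine (hl.union hfar).mono fun z hz => ?_
  by_cases h : z ∈ ball a r
  · exact Or.inl ⟨hz, h⟩
  · refine Or.inr ⟨hz, fun h' => h ?_⟩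
    rw [mem_closedBall] at h'
    rw [mem_ball]
    linarith

/-- Composition with a chart whose derivative is `κ / Q`. -/
lemma mul_comp {Q h s : ℂ → ℂ} {κ : ℂ} {C : ℝ} (hQ : TameOn φ S Q)
    (hs : ∀ z ∈ S, DifferentiableAt ℂ s z) (hsd : ∀ z ∈ S, Q z * deriv s z = κ)
    (hh : ∀ z ∈ S, DifferentiableAt ℂ h (s z))
    (hC : ∀ z ∈ S, ‖h (s z)‖ ≤ C ∧ ‖deriv h (s z)‖ ≤ C) :
    TameOn φ S (fun z => Q z * h (s z)) := by
  obtain ⟨D, hD0, hD⟩ := hQ.exists_bound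
  have hcd : ∀ z ∈ S, DifferentiableAt ℂ (fun z => h (s z)) z := fun z hz =>
    (hh z hz).comp z (hs z hz)
  refine ⟨fun z hz => (hQ.1 z hz).mul (hcd z hz), D * C + ‖κ‖ * C, fun z hz => ?_⟩
  have hC0 : 0 ≤ C := (norm_nonneg _).trans (hC z hz).1
  have hp : 1 ≤ 1 + ‖φ z‖ := by linarith [norm_nonneg (φ z)]
  constructor
  · rw [norm_mul]
    have := mul_le_mul (hD z hz).1 (hC z hz).1 (norm_nonneg _) hD0
    have : 0 ≤ ‖κ‖ * C := by positivity
    linarith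
  · rw [deriv_fun_mul (hQ.1 z hz) (hcd z hz)]
    have hc : deriv (fun z => h (s z)) z = deriv h (s z) * deriv s z :=
      deriv_comp z (hh z hz) (hs z hz)
    have e : Q z * (deriv h (s z) * deriv s z) = κ * deriv h (s z) := by
      rw [← hsd z hz]; ring
    rw [hc, e]
    refine (norm_add_le _ _).trans ?_
    rw [norm_mul, norm_mul, add_mul]
    apply add_le_add
    · calc _ ≤ D * (1 + ‖φ z‖) * C :=
            mul_le_mul (hD z hz).2 (hC z hz).1 (norm_nonneg _) (by positivity)
        _ = _ := by ring
    · calc _ ≤ ‖κ‖ * C := by gcongr; exact (hC z hz).2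
        _ ≤ _ := le_mul_of_one_le_right (by positivity) hp

end TameOn

lemma norm_bpt (t : ℝ) : ‖bpt t‖ = 1 := by
  rw [bpt, mul_comm]; exact Complex.norm_exp_ofReal_mul_I t

lemma memHardy2_of_bounded {k : ℂ → ℂ} (hd : DifferentiableOn ℂ k disc) {C : ℝ}
    (hC : ∀ z ∈ disc, ‖k z‖ ≤ C) : MemHardy2 k := by
  refine ⟨hd, C ^ 2, ?_⟩
  rintro x ⟨r, hr0, hr1, rfl⟩
  have hpi := Real.pi_pos
  have := intervalIntegral.norm_integral_le_of_norm_le_const (a := 0) (b := 2 * Real.pi)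
    (C := C ^ 2) (f := fun t : ℝ => ‖k ((r : ℂ) * bpt t)‖ ^ 2) (fun t _ => by
      rw [norm_pow, norm_norm]
      gcongr
      apply hC
      rw [mem_disc, norm_mul, norm_bpt, mul_one, Complex.norm_real, Real.norm_of_nonneg hr0.le]
      exact hr1)
  rw [sub_zero, abs_of_pos (by positivity : (0 : ℝ) < 2 * Real.pi)] at this
  have h2 := (Real.le_norm_self _).trans this
  rw [one_div, inv_mul_le_iff₀ (by positivity)]
  linarith

lemma TameOn.memA {μ : Measure ℂ} [IsFiniteMeasure μ] (hμ : OnCircle μ) {f k : ℂ → ℂ}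
    (hf : MemA μ f) (hk : TameOn (deriv f) disc k) : MemA μ k := by
  obtain ⟨C, hC0, hC⟩ := hk.exists_bound
  have hd : DifferentiableOn ℂ k disc := fun z hz => (hk.1 z hz).differentiableWithinAt
  refine ⟨⟨memHardy2_of_bounded hd fun z hz => (hC z hz).1, ?_⟩, hd, C, fun z hz => (hC z hz).1⟩
  have hP := integrableOn_poissonMu hμ
  have hmaj : IntegrableOn (fun z => 2 * C ^ 2 * (poissonMu μ z + dirichletDensity μ f z)) disc :=
    (hP.add hf.1.2).const_mul _
  refine hmaj.mono' ?_ ?_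
  · exact ((measurable_deriv k).norm.pow_const 2).aestronglyMeasurable.mul
      hP.aestronglyMeasurable
  · filter_upwards [ae_restrict_mem isOpen_disc.measurableSet] with z hz
    have hp := poissonMu_nonneg hμ hz
    rw [dirichletDensity, dirichletDensity, Real.norm_of_nonneg (by positivity)]
    have h1 : ‖deriv k z‖ ^ 2 ≤ (C * (1 + ‖deriv f z‖)) ^ 2 := by
      gcongr; exact (hC z hz).2
    have h2 : (C * (1 + ‖deriv f z‖)) ^ 2 ≤ 2 * C ^ 2 * (1 + ‖deriv f z‖ ^ 2) := by
      nlinarith [mul_nonneg (sq_nonneg C) (sq_nonneg (1 - ‖deriv f z‖))]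
    calc _ ≤ 2 * C ^ 2 * (1 + ‖deriv f z‖ ^ 2) * poissonMu μ z := by
          gcongr; exact h1.trans h2
      _ = _ := by ring

lemma tameOn_self {μ : Measure ℂ} {f : ℂ → ℂ} (hf : MemA μ f) : TameOn (deriv f) disc f := by
  obtain ⟨_, hd, C, hC⟩ := hf
  refine ⟨fun z hz => (hd z hz).differentiableAt (isOpen_disc.mem_nhds hz), max C 1,
    fun z hz => ⟨(hC z hz).trans (le_max_left _ _), ?_⟩⟩
  have : 1 ≤ max C 1 := le_max_right _ _
  nlinarith [norm_nonneg (deriv f z)]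

/-- A logarithmic chart at `1` straightening two circular arcs through `1` and its
inverse on a strip. -/
lemma exists_chart_one {ε : ℝ} (hε : 0 < ε) :
    ∃ (s ζ Q : ℂ → ℂ) (κ : ℂ), Differentiable ℂ Q ∧ Q 1 ≠ 0 ∧ s 1 = 0 ∧
      (∀ᶠ z in 𝓝 1, DifferentiableAt ℂ s z) ∧
      (∀ z, ‖z‖ < 1 → 0 < (s z).im ∧ (s z).im < 4 ∧ DifferentiableAt ℂ s z ∧
        Q z * deriv s z = κ ∧ ζ (s z) = z) ∧
      (∀ u, 0 < u.im → u.im < 3 / 2 → ‖ζ u‖ < 1 ∧ ‖ζ u - 1‖ < 2 * ε ∧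
        DifferentiableAt ℂ ζ u) := by
  set α : ℂ := ε + I with hα
  set β : ℂ := ε - I with hβ
  have hαβ : ‖α‖ = ‖β‖ := by
    have : β = (starRingEnd ℂ) α := by simp [hα, hβ, sub_eq_add_neg]
    rw [this, Complex.norm_conj]
  have hα0 : 0 < ‖α‖ := norm_pos_iff.2 fun h => by
    have := congrArg Complex.im h
    simp [hα] at this
  have hε0 : (ε : ℂ) ≠ 0 := by exact_mod_cast hε.ne'
  have hdiff : β ^ 2 - α ^ 2 = -4 * ε * I := by rw [hα, hβ]; ring
  have hdiff0 : -4 * (ε : ℂ) * I ≠ 0 := by simp [hε0]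
  set N : ℂ → ℂ := fun z => β * z + α with hN
  set D : ℂ → ℂ := fun z => α * z + β with hD
  set m : ℂ → ℂ := fun z => N z / D z with hm
  set num : ℂ → ℂ := fun w => w * β - α with hnum
  set den : ℂ → ℂ := fun w => β - w * α with hden
  have hND : ∀ z, HasDerivAt N β z := fun z =>
    (((hasDerivAt_id z).const_mul β).add_const α).congr_deriv (mul_one β)
  have hDD : ∀ z, HasDerivAt D α z := fun z =>
    (((hasDerivAt_id z).const_mul α).add_const β).congr_deriv (mul_one α)
  have hm' : ∀ z, D z ≠ 0 → HasDerivAt m ((β * D z - N z * α) / D z ^ 2) z := fun z hz =>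
    (hND z).div (hDD z) hz
  have hs' : ∀ z, D z ≠ 0 → m z ∈ slitPlane →
      HasDerivAt (fun z => Complex.log (m z)) ((β * D z - N z * α) / D z ^ 2 / m z) z :=
    fun z hz hz' => (hm' z hz).clog hz'
  have hD1 : D 1 = 2 * ε := by simp only [hD, hα, hβ]; ring
  have hN1 : N 1 = 2 * ε := by simp only [hN, hα, hβ]; ring
  have h2ε : (2 * ε : ℂ) ≠ 0 := mul_ne_zero two_ne_zero hε0
  have hm1 : m 1 = 1 := by simp only [hm, hD1, hN1]; exact div_self h2ε
  have hDne : ∀ z, ‖z‖ < 1 → D z ≠ 0 := by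
    intro z hz h
    have h1 : α * z = -β := eq_neg_of_add_eq_zero_left h
    have h2 : ‖α‖ * ‖z‖ = ‖α‖ := by rw [← norm_mul, h1, norm_neg, hαβ]
    nlinarith
  have hmim : ∀ z, ‖z‖ < 1 → 0 < (m z).im := by
    intro z hz
    have hns : 0 < normSq (D z) := normSq_pos.2 (hDne z hz)
    have hz2 : z.re ^ 2 + z.im ^ 2 < 1 := by
      have := Complex.sq_norm z
      rw [normSq_apply] at this
      nlinarith [norm_nonneg z]
    simp only [hm]
    rw [Complex.div_im, ← sub_div]
    apply div_pos _ hns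
    have : (N z).im * (D z).re - (N z).re * (D z).im
        = 2 * ε * (1 - (z.re ^ 2 + z.im ^ 2)) := by
      simp [hN, hD, hα, hβ]; ring
    rw [this]
    have : 0 < 1 - (z.re ^ 2 + z.im ^ 2) := by linarith
    positivity
  refine ⟨fun z => Complex.log (m z), fun u => num (exp u) / den (exp u), fun z => N z * D z,
    -4 * ε * I, ?_, ?_, ?_, ?_, ?_, ?_⟩
  · exact fun z => ((hND z).mul (hDD z)).differentiableAt
  · simp only [hN1, hD1]; exact mul_ne_zero h2ε h2ε
  · simp only [hm1, Complex.log_one]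
  · have h1 : ∀ᶠ z in 𝓝 (1 : ℂ), D z ≠ 0 :=
      (hDD 1).continuousAt.eventually_ne (by rw [hD1]; exact h2ε)
    have h2 : ∀ᶠ z in 𝓝 (1 : ℂ), m z ∈ slitPlane :=
      (hm' 1 (by rw [hD1]; exact h2ε)).continuousAt.eventually_mem
        (isOpen_slitPlane.mem_nhds (by rw [hm1]; simp))
    filter_upwards [h1, h2] with z hz hz' using (hs' z hz hz').differentiableAt
  · intro z hz
    have him := hmim z hz
    have hD0 := hDne z hz
    have hm0 : m z ≠ 0 := fun h => by rw [h] at him; simp at him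
    have hN0 : N z ≠ 0 := fun h => hm0 (by simp only [hm, h, zero_div])
    have hsl : m z ∈ slitPlane := Or.inr him.ne'
    refine ⟨?_, ?_, (hs' z hD0 hsl).differentiableAt, ?_, ?_⟩
    · rw [Complex.log_im]
      rcases (Complex.arg_nonneg_iff.2 him.le).lt_or_eq with h | h
      · exact h
      · exact absurd (Complex.arg_eq_zero_iff.1 h.symm).2 him.ne'
    · rw [Complex.log_im]
      have := Complex.arg_le_pi (m z)
      have := Real.pi_lt_d2
      linarith
    · rw [(hs' z hD0 hsl).deriv, ← hdiff]
      have e : β * D z - N z * α = β ^ 2 - α ^ 2 := by simp only [hN, hD]; ring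
      rw [e]
      simp only [hm]
      field_simp
    · have e1 : num (m z) = -4 * ε * I * z / D z := by
        rw [← hdiff, eq_div_iff hD0]
        simp only [hnum, hm]
        rw [sub_mul, mul_right_comm, div_mul_cancel₀ _ hD0]
        simp only [hN, hD]; ring
      have e2 : den (m z) = -4 * ε * I / D z := by
        rw [← hdiff, eq_div_iff hD0]
        simp only [hden, hm]
        rw [sub_mul, mul_right_comm, div_mul_cancel₀ _ hD0]
        simp only [hN, hD]; ring
      simp only [Complex.exp_log hm0, e1, e2]
      field_simp
  · intro u h0 h1
    set w := exp u with hw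
    have hp : 0 < w.re := by
      rw [hw, Complex.exp_re]
      have := Real.pi_gt_d2
      exact mul_pos (Real.exp_pos _) (Real.cos_pos_of_mem_Ioo ⟨by linarith, by linarith⟩)
    have hq : 0 < w.im := by
      rw [hw, Complex.exp_im]
      have := Real.pi_gt_d2
      exact mul_pos (Real.exp_pos _) (Real.sin_pos_of_pos_of_lt_pi h0 (by linarith))
    have hεq : 0 < ε * w.im := mul_pos hε hq
    have hnd : normSq (num w) < normSq (den w) := by
      simp [hnum, hden, hα, hβ, normSq_apply]
      nlinarith
    have hd0 : den w ≠ 0 := normSq_pos.1 ((normSq_nonneg _).trans_lt hnd)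
    have hwd : normSq (w - 1) < normSq (den w) := by
      simp [hden, hα, hβ, normSq_apply]
      nlinarith [sq_nonneg (ε * (1 - w.re)), sq_nonneg (ε * w.im)]
    have key : ∀ x y : ℂ, normSq x < normSq y → ‖x‖ < ‖y‖ := fun x y h => by
      rw [normSq_eq_norm_sq, normSq_eq_norm_sq] at h
      exact lt_of_pow_lt_pow_left₀ 2 (norm_nonneg _) h
    refine ⟨?_, ?_, ?_⟩
    · rw [norm_div, div_lt_one (norm_pos_iff.2 hd0)]
      exact key _ _ hnd
    · have e : num w / den w - 1 = 2 * ε * (w - 1) / den w := by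
        rw [div_sub_one hd0]
        congr 1
        simp only [hnum, hden, hα, hβ]; ring
      rw [e, norm_div, norm_mul, div_lt_iff₀ (norm_pos_iff.2 hd0)]
      have : ‖(2 * ε : ℂ)‖ = 2 * ε := by
        rw [norm_mul, Complex.norm_real, Real.norm_of_nonneg hε.le]; simp
      rw [this]
      exact mul_lt_mul_of_pos_left (key _ _ hwd) (by positivity)
    · have hdn : DifferentiableAt ℂ (fun u => num (exp u)) u := by
        simp only [hnum]; fun_prop
      have hdd : DifferentiableAt ℂ (fun u => den (exp u)) u := by
        simp only [hden]; fun_prop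
      exact hdn.div hdd hd0

lemma exists_chart {a : ℂ} (ha : ‖a‖ = 1) {r : ℝ} (hr : 0 < r) :
    ∃ (s ζ Q : ℂ → ℂ) (κ : ℂ), Differentiable ℂ Q ∧ Q a ≠ 0 ∧ s a = 0 ∧
      (∀ᶠ z in 𝓝 a, DifferentiableAt ℂ s z) ∧
      (∀ z ∈ disc, 0 < (s z).im ∧ (s z).im < 4 ∧ DifferentiableAt ℂ s z ∧
        Q z * deriv s z = κ ∧ ζ (s z) = z) ∧
      (∀ u, 0 < u.im → u.im < 3 / 2 → ζ u ∈ disc ∩ ball a r ∧ DifferentiableAt ℂ ζ u) := by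
  obtain ⟨s, ζ, Q, κ, hQ, hQ1, hs1, hsn, hs, hζ⟩ := exists_chart_one (half_pos hr)
  have ha0 : a ≠ 0 := norm_pos_iff.1 (by rw [ha]; exact one_pos)
  have hda : ∀ z, HasDerivAt (fun z => z / a) (1 / a) z := fun z => (hasDerivAt_id z).div_const a
  have haa : a / a = 1 := div_self ha0
  refine ⟨fun z => s (z / a), fun u => a * ζ u, fun z => Q (z / a), κ / a, ?_, ?_, ?_, ?_, ?_, ?_⟩
  · exact hQ.comp (differentiable_id.div_const a)
  · simpa only [haa] using hQ1
  · simpa only [haa] using hs1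
  · have ht : Tendsto (fun z => z / a) (𝓝 a) (𝓝 1) := by
      have := (hda a).continuousAt.tendsto
      rwa [haa] at this
    filter_upwards [ht.eventually hsn] with z hz
    exact hz.comp z (hda z).differentiableAt
  · intro z hz
    have hz' : ‖z / a‖ < 1 := by rw [norm_div, ha, div_one]; exact mem_disc.1 hz
    obtain ⟨h1, h2, h3, h4, h5⟩ := hs _ hz'
    have hc := h3.hasDerivAt.comp z (hda z)
    refine ⟨h1, h2, hc.differentiableAt, ?_, ?_⟩
    · have : deriv (fun z => s (z / a)) z = deriv s (z / a) * (1 / a) := hc.deriv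
      rw [this, ← h4]
      ring
    · simp only [h5]; field_simp
  · intro u h0 h1
    obtain ⟨h2, h3, h4⟩ := hζ u h0 h1
    refine ⟨⟨?_, ?_⟩, h4.const_mul a⟩
    · rw [mem_disc, norm_mul, ha, one_mul]; exact h2
    · have : a * ζ u - a = a * (ζ u - 1) := by ring
      rw [mem_ball, dist_eq_norm, this, norm_mul, ha, one_mul]
      linarith

lemma tameOn_dslope {φ h : ℂ → ℂ} {a : ℂ} {ρ : ℝ} (hρ : 0 < ρ)
    (hh : DifferentiableOn ℂ h (ball a ρ)) :
    TameOn φ (ball a (ρ / 2)) (dslope h a) :=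
  (TameOn.of_compact (isCompact_closedBall a (ρ / 2)) isOpen_ball
    (closedBall_subset_ball (half_lt_self hρ))
    ((Complex.differentiableOn_dslope (ball_mem_nhds a hρ)).2 hh)).mono ball_subset_closedBall

lemma sub_mul_dslope (h : ℂ → ℂ) (a z : ℂ) : (a - z) * dslope h a z = h a - h z := by
  have := sub_smul_dslope h a z
  rw [smul_eq_mul] at this
  linear_combination -this

/-- If `f` is bounded below near a boundary point `a`, then `a - z` is invertible modulo `f`. -/
lemma exists_sub_mul_eq_of_boundary {φ f : ℂ → ℂ} (hf : TameOn φ disc f) {a : ℂ} (ha : ‖a‖ = 1)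
    {δ r : ℝ} (hδ : 0 < δ) (hr : 0 < r) (hlow : ∀ z ∈ disc ∩ ball a r, δ ≤ ‖f z‖) :
    ∃ (e g : ℂ → ℂ) (c : ℂ), c ≠ 0 ∧ TameOn φ disc e ∧ TameOn φ disc g ∧
      ∀ z ∈ disc, (a - z) * e z = c - f z * g z := by
  obtain ⟨s, ζ, Q, κ, hQ, hQa, hsa, hsn, hs, hζ⟩ := exists_chart ha hr
  have hQt : TameOn φ disc Q := .of_differentiable hQ
  obtain ⟨A, B, C, hAB, hA, hB, hAC, hBC, hB0⟩ := exists_strip_splitting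
    (F := fun u => (f (ζ u))⁻¹) (M := δ⁻¹)
    (fun u h0 h1 => by
      obtain ⟨h2, h3⟩ := hζ u h0 h1
      exact ((hf.1 _ h2.1).comp u h3).inv (norm_pos_iff.1 (hδ.trans_le (hlow _ h2))))
    (fun u h0 h1 => by
      rw [norm_inv]
      exact inv_anti₀ hδ (hlow _ (hζ u h0 h1).1))
  have hflow : ∀ z ∈ disc, (s z).im < 3 / 2 → δ ≤ ‖f z‖ := fun z hz h => by
    obtain ⟨h0, -, -, -, h4⟩ := hs z hz
    have := hlow _ (hζ (s z) h0 h).1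
    rwa [h4] at this
  have hAB' : ∀ z ∈ disc, 1 / 2 < (s z).im → (s z).im < 1 →
      (f z)⁻¹ + B (s z) = A (s z) := fun z hz h0 h1 => by
    have := hAB (s z) h0 h1
    simp only [(hs z hz).2.2.2.2] at this
    linear_combination this
  have hcont : ContinuousOn (fun z => (s z).im) disc := fun z hz =>
    (Complex.continuous_im.continuousAt.comp
      (hs z hz).2.2.1.continuousAt).continuousWithinAt
  have hop1 : IsOpen (disc ∩ (fun z => (s z).im) ⁻¹' Ioi (1 / 2)) :=
    hcont.isOpen_inter_preimage isOpen_disc isOpen_Ioi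
  have hop2 : IsOpen (disc ∩ (fun z => (s z).im) ⁻¹' Iio 1) :=
    hcont.isOpen_inter_preimage isOpen_disc isOpen_Iio
  set g : ℂ → ℂ := fun z =>
    if (s z).im ≤ 3 / 4 then Q z * (f z)⁻¹ + Q z * B (s z) else Q z * A (s z) with hg
  have hg1 : EqOn g (fun z => Q z * A (s z)) (disc ∩ (fun z => (s z).im) ⁻¹' Ioi (1 / 2)) := by
    intro z hz
    simp only [hg]
    split_ifs with h
    · rw [← mul_add, hAB' z hz.1 hz.2 (by linarith)]
    · rfl
  have hg2 : EqOn g (fun z => Q z * (f z)⁻¹ + Q z * B (s z))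
      (disc ∩ (fun z => (s z).im) ⁻¹' Iio 1) := by
    intro z hz
    simp only [hg]
    split_ifs with h
    · rfl
    · rw [← mul_add, hAB' z hz.1 (by linarith) hz.2]
  have hgt1 : TameOn φ {z | z ∈ disc ∧ 3 / 4 ≤ (s z).im} g := by
    refine TameOn.congr (TameOn.mul_comp (h := A) (s := s) (κ := κ) (C := C)
      (hQt.mono fun z hz => hz.1)
      (fun z hz => (hs z hz.1).2.2.1) (fun z hz => (hs z hz.1).2.2.2.1)
      (fun z hz => hA _ (by linarith [hz.2]) (hs z hz.1).2.1)
      fun z hz => hAC _ hz.2 (hs z hz.1).2.1) fun z hz => ?_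
    exact hg1.eventuallyEq_of_mem (hop1.mem_nhds ⟨hz.1, by
      rw [mem_preimage, mem_Ioi]; linarith [hz.2]⟩)
  have hgt2 : TameOn φ {z | z ∈ disc ∧ (s z).im ≤ 3 / 4} g := by
    have hsub : {z | z ∈ disc ∧ (s z).im ≤ 3 / 4} ⊆ disc := fun z hz => hz.1
    refine TameOn.congr (((hQt.mono hsub).mul ((hf.mono hsub).inv hδ
      fun z hz => hflow z hz.1 (by linarith [hz.2]))).add
      (TameOn.mul_comp (h := B) (s := s) (κ := κ) (C := C) (hQt.mono hsub)
      (fun z hz => (hs z hz.1).2.2.1) (fun z hz => (hs z hz.1).2.2.2.1)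
      (fun z hz => hB _ (by linarith [hz.2]))
      fun z hz => hBC _ hz.2)) fun z hz => ?_
    exact hg2.eventuallyEq_of_mem (hop2.mem_nhds ⟨hz.1, by
      rw [mem_preimage, mem_Iio]; linarith [hz.2]⟩)
  have hgt : TameOn φ disc g := (hgt1.union hgt2).mono fun z hz =>
    (le_total (3 / 4) (s z).im).imp (fun h => ⟨hz, h⟩) fun h => ⟨hz, h⟩
  have hne : ∀ z ∈ disc, a - z ≠ 0 := fun z hz h => by
    have := mem_disc.1 hz
    rw [← sub_eq_zero.1 h, ha] at this
    exact lt_irrefl _ this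
  have he : ∀ z ∈ disc, (a - z) * ((Q a - f z * g z) / (a - z)) = Q a - f z * g z :=
    fun z hz => mul_div_cancel₀ _ (hne z hz)
  have hnear : ∀ᶠ z in 𝓝 a, DifferentiableAt ℂ s z ∧ (s z).im < 1 := by
    refine hsn.and ?_
    have hc : ContinuousAt (fun z => (s z).im) a :=
      Complex.continuous_im.continuousAt.comp hsn.self_of_nhds.continuousAt
    exact hc.eventually_lt_const (by simp [hsa])
  obtain ⟨ρ, hρ, hρs⟩ := Metric.eventually_nhds_iff_ball.1 hnear
  have hBs : DifferentiableOn ℂ (fun z => B (s z)) (ball a ρ) := fun z hz =>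
    ((hB _ (hρs z hz).2).comp z (hρs z hz).1).differentiableWithinAt
  refine ⟨fun z => (Q a - f z * g z) / (a - z), g, Q a, hQa, ?_, hgt, he⟩
  refine TameOn.of_sub_mul (half_pos hρ) ((TameOn.const (Q a)).sub (hf.mul hgt)) he ?_
  have hQd := (tameOn_dslope (φ := φ) (a := a) hρ hQ.differentiableOn).mono
    (inter_subset_right (s := disc))
  have hBd := (tameOn_dslope (φ := φ) hρ hBs).mono (inter_subset_right (s := disc))
  refine (hQd.add ((hf.mono inter_subset_left).mul
    ((hQt.mono inter_subset_left).mul hBd))).congr_of_isOpen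
    (isOpen_disc.inter isOpen_ball) fun z hz => ?_
  have hz1 : (s z).im < 1 := (hρs z (ball_subset_ball (by linarith) hz.2)).2
  have hf0 : f z ≠ 0 := norm_pos_iff.1 (hδ.trans_le (hflow z hz.1 (by linarith)))
  apply mul_left_cancel₀ (hne z hz.1)
  simp only
  rw [he z hz.1, hg2 ⟨hz.1, hz1⟩]
  have e1 := sub_mul_dslope Q a z
  have e2 := sub_mul_dslope (fun z => B (s z)) a z
  simp only [hsa, hB0] at e2
  have e3 : f z * (f z)⁻¹ = 1 := mul_inv_cancel₀ hf0
  linear_combination -e1 - f z * Q z * e2 - Q z * e3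

lemma exists_sub_mul_eq_of_interior {φ f : ℂ → ℂ} (hf : TameOn φ disc f) {a : ℂ}
    (ha : a ∈ disc) :
    ∃ e : ℂ → ℂ, TameOn φ disc e ∧ ∀ z ∈ disc, (a - z) * e z = f a - f z := by
  obtain ⟨ρ, hρ, hρs⟩ := Metric.isOpen_iff.1 isOpen_disc a ha
  have hd : DifferentiableOn ℂ f (ball a ρ) := fun z hz =>
    (hf.1 z (hρs hz)).differentiableWithinAt
  exact ⟨dslope f a, TameOn.of_sub_mul (half_pos hρ) ((TameOn.const (f a)).sub hf)
    (fun z _ => sub_mul_dslope f a z) ((tameOn_dslope hρ hd).mono inter_subset_right),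
    fun z _ => sub_mul_dslope f a z⟩

lemma exists_sub_mul_eq_one_of_exterior {φ : ℂ → ℂ} {a : ℂ} (ha : 1 < ‖a‖) :
    ∃ e : ℂ → ℂ, TameOn φ disc e ∧ ∀ z ∈ disc, (a - z) * e z = 1 := by
  have hlow : ∀ z ∈ disc, ‖a‖ - 1 ≤ ‖a - z‖ := fun z hz => by
    have := norm_sub_norm_le a z
    have := mem_disc.1 hz
    linarith
  refine ⟨fun z => (a - z)⁻¹, TameOn.inv (.of_differentiable (by fun_prop)) (sub_pos.2 ha) hlow,
    fun z hz => mul_inv_cancel₀ (norm_pos_iff.1 ((sub_pos.2 ha).trans_le (hlow z hz)))⟩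

namespace ClosedIdeal

variable {μ : Measure ℂ} {J : Set (ℂ → ℂ)}

/-- Membership in a closed ideal only depends on the values on the disc. -/
lemma mem_of_eqOn (hJ : ClosedIdeal μ J) {h k : ℂ → ℂ} (hh : h ∈ J) (hk : MemA μ k)
    (e : EqOn k h disc) : k ∈ J := by
  refine hJ.closed k hk fun ε hε => ⟨h, hh, ?_⟩
  have h0 : EqOn (fun z => k z - h z) (fun _ => 0) disc := fun z hz => sub_eq_zero.2 (e hz)
  have h1 : supNorm (fun z => k z - h z) = 0 := by
    have : (fun z => ‖k z - h z‖) '' disc = {0} := by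
      rw [EqOn.image_eq (f₂ := fun _ => (0 : ℝ)) fun z hz => by
        simpa using h0 hz]
      exact Nonempty.image_const ⟨0, by simp [disc]⟩ 0
    rw [supNorm, this, csSup_singleton]
  have h2 : dirichletIntegral μ (fun z => k z - h z) = 0 := by
    rw [dirichletIntegral, setIntegral_congr_fun (g := fun _ => (0 : ℝ))
      isOpen_disc.measurableSet fun z hz => ?_]
    · simp
    · have : deriv (fun z => k z - h z) z = 0 := by
        rw [(h0.eventuallyEq_of_mem (isOpen_disc.mem_nhds hz)).deriv_eq, deriv_const]
      simp [dirichletDensity, this]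
  rw [algNorm, h1, h2]
  simpa using hε

/-- A factorisation `(a - z) e = c - f g` inverts `a - z` modulo a closed ideal containing `f`. -/
lemma exists_inverse [IsFiniteMeasure μ] (hμ : OnCircle μ) (hJ : ClosedIdeal μ J)
    {f e g : ℂ → ℂ} {a c : ℂ} (hf : f ∈ J) (hc : c ≠ 0) (he : TameOn (deriv f) disc e)
    (hg : TameOn (deriv f) disc g) (heq : ∀ z ∈ disc, (a - z) * e z = c - f z * g z) :
    ∃ ψ : ℂ → ℂ, MemA μ ψ ∧ (fun z => (a - z) * ψ z - 1) ∈ J := by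
  have hfA : MemA μ f := hJ.subset hf
  have hψ : TameOn (deriv f) disc (fun z => c⁻¹ * e z) := (TameOn.const c⁻¹).mul he
  have hlin : TameOn (deriv f) disc (fun z => a - z) := .of_differentiable (by fun_prop)
  refine ⟨fun z => c⁻¹ * e z, hψ.memA hμ hfA, ?_⟩
  refine hJ.mem_of_eqOn (hJ.mul_mem _ (((TameOn.const (-c⁻¹)).mul hg).memA hμ hfA) f hf)
    (((hlin.mul hψ).sub (.const 1)).memA hμ hfA) fun z hz => ?_
  simp only
  have h := heq z hz
  have h' : c⁻¹ * c = 1 := inv_mul_cancel₀ hc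
  linear_combination c⁻¹ * h + h'

end ClosedIdeal

lemma neBot_nhdsWithin_disc {a : ℂ} (ha : a ∈ closedBall (0 : ℂ) 1) : (𝓝[disc] a).NeBot := by
  rw [← mem_closure_iff_nhdsWithin_neBot, disc, closure_ball 0 one_ne_zero]
  exact ha

/-- A bounded function off whose lower zero set a point lies is bounded below near it. -/
lemma exists_lower_bound {f : ℂ → ℂ} (hf : MemHinf f) {a : ℂ} (ha : a ∈ closedBall (0 : ℂ) 1)
    (h : a ∉ Zlow f) :
    ∃ δ > 0, ∃ r > 0, ∀ z ∈ disc ∩ ball a r, δ ≤ ‖f z‖ := by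
  have := neBot_nhdsWithin_disc ha
  obtain ⟨C, hC⟩ := hf.2
  have hb : IsBoundedUnder (· ≥ ·) (𝓝[disc] a) (fun z => ‖f z‖) :=
    isBoundedUnder_of ⟨0, fun z => norm_nonneg _⟩
  have hcb : IsCoboundedUnder (· ≥ ·) (𝓝[disc] a) (fun z => ‖f z‖) :=
    (isBoundedUnder_of_eventually_le (a := C) (by
      filter_upwards [self_mem_nhdsWithin] with z hz using hC z hz)).isCoboundedUnder_ge
  have h0 : 0 ≤ liminf (fun z => ‖f z‖) (𝓝[disc] a) :=
    le_liminf_of_le hcb (Eventually.of_forall fun z => norm_nonneg _)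
  have h1 : 0 < liminf (fun z => ‖f z‖) (𝓝[disc] a) :=
    h0.lt_of_ne fun h' => h ⟨ha, h'.symm⟩
  have h2 := eventually_lt_of_lt_liminf (half_lt_self h1) hb
  obtain ⟨r, hr, hrs⟩ := Metric.mem_nhdsWithin_iff.1 h2
  exact ⟨_, half_pos h1, r, hr, fun z hz => (hrs ⟨hz.2, hz.1⟩).le⟩

lemma notMem_Zlow_sub_mul_sub_one {ψ : ℂ → ℂ} (hψ : MemHinf ψ) (a : ℂ) :
    a ∉ Zlow fun z => (a - z) * ψ z - 1 := by
  rintro ⟨ha, h⟩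
  have := neBot_nhdsWithin_disc ha
  obtain ⟨C, hC⟩ := hψ.2
  have h1 : Tendsto (fun z => (a - z) * ψ z) (𝓝[disc] a) (𝓝 0) := by
    have h2 : Tendsto (fun z => ‖a - z‖ * C) (𝓝[disc] a) (𝓝 0) := by
      have : Continuous fun z => ‖a - z‖ * C := by fun_prop
      simpa using (this.tendsto a).mono_left nhdsWithin_le_nhds
    refine squeeze_zero_norm' ?_ h2
    filter_upwards [self_mem_nhdsWithin] with z hz
    rw [norm_mul]
    exact mul_le_mul_of_nonneg_left (hC z hz) (norm_nonneg _)
  have h3 := (h1.sub_const 1).norm.liminf_eq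
  rw [h3] at h
  simp at h
/-- The spectrum of `π(u)` in the quotient algebra `(D(μ) ∩ H^∞)/J` equals `Z̲(J)`:
`λ` lies in the spectrum iff `λ - z` has no inverse modulo `J`. -/
theorem spectrum_quotient_eq_Zlow
    (μ : Measure ℂ) [IsFiniteMeasure μ] (hμ : OnCircle μ)
    (J : Set (ℂ → ℂ)) (hJ : ClosedIdeal μ J) :
    {l : ℂ | ¬ ∃ ψ : ℂ → ℂ, MemA μ ψ ∧ (fun z => (l - z) * ψ z - 1) ∈ J}
      = ZlowSet J := by
  ext a
  rw [mem_ofPred_eq, ZlowSet, mem_iInter₂]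
  constructor
  · intro h f hf
    by_contra hfa
    apply h
    have hfA : MemA μ f := hJ.subset hf
    have hft := tameOn_self hfA
    rcases lt_or_ge 1 ‖a‖ with ha | ha
    · obtain ⟨e, he, heq⟩ := exists_sub_mul_eq_one_of_exterior (φ := deriv f) ha
      exact hJ.exists_inverse hμ hf one_ne_zero he (.const 0) fun z hz => by simp [heq z hz]
    · obtain ⟨δ, hδ, r, hr, hlow⟩ :=
        exists_lower_bound hfA.2 (mem_closedBall_zero_iff.2 ha) hfa
      rcases ha.lt_or_eq with ha | ha
      · obtain ⟨e, he, heq⟩ := exists_sub_mul_eq_of_interior hft (mem_disc.2 ha)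
        have hfa0 : f a ≠ 0 :=
          norm_pos_iff.1 (hδ.trans_le (hlow a ⟨mem_disc.2 ha, mem_ball_self hr⟩))
        exact hJ.exists_inverse hμ hf hfa0 he (.const 1) fun z hz => by simp [heq z hz]
      · obtain ⟨e, g, c, hc, he, hg, heq⟩ := exists_sub_mul_eq_of_boundary hft ha hδ hr hlow
        exact hJ.exists_inverse hμ hf hc he hg heq
  · rintro h ⟨ψ, hψ, hmem⟩
    exact notMem_Zlow_sub_mul_sub_one hψ.2 a (h _ hmem)

end DirichletMu
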